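/- arXiv:2209.01451 — 2 statements merged into one kernel-verified Lean document; each statement's English description precedes it below -/
import Mathlib

section
/- Every injective polynomial mapping F : ℝⁿ → ℝⁿ is surjective, hence bijective. -/
open MvPolynomial

/-- A real polynomial of odd degree has a real root. -/
theorem exists_isRoot_of_odd_natDegree_real {f : Polynomial ℝ} (hf : Odd f.natDegree) :
    ∃ x, f.IsRoot x := by
  have key : ∀ g : Polynomial ℝ, Odd g.natDegree → 0 ≤ g.leadingCoeff → ∃ x, g.IsRoot x := by
    intro g hg hlc
    have hdeg : 0 < g.degree := Polynomial.natDegree_pos_iff_degree_pos.mp hg.pos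
    have hg' : (g.comp (-Polynomial.X)).natDegree = g.natDegree := by
      simp [Polynomial.natDegree_comp]
    have htop := g.tendsto_atTop_of_leadingCoeff_nonneg hdeg hlc
    have hbot := (g.comp (-Polynomial.X)).tendsto_atBot_of_leadingCoeff_nonpos
      (Polynomial.natDegree_pos_iff_degree_pos.mp (by rw [hg']; exact hg.pos)) (by
        rw [Polynomial.leadingCoeff_comp (by simp)]
        simpa [hg.neg_one_pow] using hlc)
    have hbot' : Filter.Tendsto (fun x => g.eval x) Filter.atBot Filter.atBot := by
      have := hbot.comp Filter.tendsto_neg_atBot_atTop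
      simpa [Function.comp_def] using this
    exact g.continuous.surjective htop hbot' 0
  rcases le_total 0 f.leadingCoeff with h | h
  · exact key f hf h
  · obtain ⟨x, hx⟩ := key (-f) (by simpa using hf) (by simpa using h)
    exact ⟨x, by simpa [Polynomial.IsRoot] using hx⟩

theorem exists_ringHom_extends {Q L : Type*} [Field Q] [Field L] [Algebra Q L]
    [FiniteDimensional Q L] [CharZero Q] (τ : Q →+* ℝ) (r : ℝ)
    (hr : (minpoly Q (Field.powerBasisOfFiniteOfSeparable Q L).gen).eval₂ τ r = 0) :
    ∃ σ : L →+* ℝ, σ.comp (algebraMap Q L) = τ ∧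
      σ (Field.powerBasisOfFiniteOfSeparable Q L).gen = r := by
  let := τ.toAlgebra
  let σ := (Field.powerBasisOfFiniteOfSeparable Q L).lift (S' := ℝ) r hr
  exact ⟨σ, σ.comp_algebraMap, PowerBasis.lift_gen _ _ hr⟩

/-- If an embedding of `Q` into `ℝ` extends uniquely to the finite extension `L`, then every
embedding of `Q` into `ℝ` extends to `L`. -/
theorem exists_ringHom_extends_of_unique {Q L : Type*} [Field Q] [Field L] [Algebra Q L]
    [FiniteDimensional Q L] [CharZero Q] (σ₀ : L →+* ℝ)
    (huniq : ∀ σ : L →+* ℝ, σ.comp (algebraMap Q L) = σ₀.comp (algebraMap Q L) → σ = σ₀)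
    (τ : Q →+* ℝ) : ∃ σ : L →+* ℝ, σ.comp (algebraMap Q L) = τ := by
  set θ := (Field.powerBasisOfFiniteOfSeparable Q L).gen with hθ
  set p := minpoly Q θ with hp
  set τ₀ := σ₀.comp (algebraMap Q L) with hτ₀
  have hint : IsIntegral Q θ := Algebra.IsIntegral.isIntegral θ
  have hroot : ∀ r, (p.map τ₀).IsRoot r → r = σ₀ θ := by
    intro r hr
    obtain ⟨σ, h1, h2⟩ := exists_ringHom_extends (L := L) τ₀ r (by
      rwa [Polynomial.IsRoot, Polynomial.eval_map] at hr)
    rw [← h2, huniq σ h1]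
  have hroot0 : (p.map τ₀).IsRoot (σ₀ θ) := by
    have h : Polynomial.aeval θ p = 0 := minpoly.aeval Q θ
    rw [Polynomial.IsRoot, Polynomial.eval_map, hτ₀, ← Polynomial.hom_eval₂, ← Polynomial.aeval_def,
      h, map_zero]
  have hsep : (p.map τ₀).Separable := Polynomial.Separable.map (Algebra.IsSeparable.isSeparable Q θ)
  obtain ⟨q, hq⟩ := Polynomial.dvd_iff_isRoot.mpr hroot0
  have hq0 : q ≠ 0 := by
    rintro rfl
    exact hsep.ne_zero (by simpa using hq)
  have hqr : ∀ r, ¬ q.IsRoot r := by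
    intro r hr
    have h1 : r = σ₀ θ := hroot r (by rw [hq]; simp [Polynomial.IsRoot, hr.eq_zero])
    obtain ⟨q', hq'⟩ := Polynomial.dvd_iff_isRoot.mpr hr
    rw [hq, hq', h1] at hsep
    have := hsep.squarefree (Polynomial.X - Polynomial.C (σ₀ θ)) ⟨q', by ring⟩
    exact Polynomial.not_isUnit_X_sub_C _ this
  have hqe : Even q.natDegree := by
    by_contra h
    obtain ⟨x, hx⟩ := exists_isRoot_of_odd_natDegree_real (Nat.not_even_iff_odd.mp h)
    exact hqr x hx
  have hodd : Odd (p.map τ).natDegree := by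
    have : (p.map τ₀).natDegree = 1 + q.natDegree := by
      rw [hq, Polynomial.natDegree_mul (Polynomial.X_sub_C_ne_zero _) hq0,
        Polynomial.natDegree_X_sub_C]
    rw [Polynomial.natDegree_map] at this ⊢
    rw [this]
    exact Even.one_add hqe
  obtain ⟨r, hr⟩ := exists_isRoot_of_odd_natDegree_real hodd
  obtain ⟨σ, h1, -⟩ := exists_ringHom_extends (L := L) τ r (by
    rwa [Polynomial.IsRoot, Polynomial.eval_map] at hr)
  exact ⟨σ, h1⟩

/-- A function with nonzero derivative at a zero changes sign there. -/
theorem exists_mul_neg_of_hasDerivAt {f : ℝ → ℝ} {f' x : ℝ} (hf : HasDerivAt f f' x)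
    (hx : f x = 0) (hf' : f' ≠ 0) : ∃ a b, f a * f b < 0 := by
  have h := hasDerivAt_iff_tendsto_slope.mp hf
  have key : ∀ᶠ y in nhdsWithin x {x}ᶜ, 0 < f y / (y - x) * f' := by
    have h2 : Filter.Tendsto (fun y => slope f x y * f') (nhdsWithin x {x}ᶜ) (nhds (f' * f')) :=
      h.mul_const _
    filter_upwards [h2.eventually (lt_mem_nhds (mul_self_pos.mpr hf'))] with y hy
    simpa [slope_def_field, hx] using hy
  have hr := key.filter_mono (nhdsWithin_mono x (s := Set.Ioi x) (fun y hy => ne_of_gt hy))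
  have hl := key.filter_mono (nhdsWithin_mono x (s := Set.Iio x) (fun y hy => ne_of_lt hy))
  obtain ⟨b, hb, hb'⟩ := (hr.and self_mem_nhdsWithin).exists
  obtain ⟨a, ha, ha'⟩ := (hl.and self_mem_nhdsWithin).exists
  refine ⟨a, b, ?_⟩
  have hb' : 0 < b - x := sub_pos.mpr hb'
  have ha' : a - x < 0 := sub_neg.mpr ha'
  have : 0 < f a * f b * ((f' * f') / ((a - x) * (b - x))) := by
    calc 0 < (f a / (a - x) * f') * (f b / (b - x) * f') := mul_pos ha hb
      _ = _ := by field_simp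
  by_contra hcon
  push Not at hcon
  have : (f' * f') / ((a - x) * (b - x)) < 0 :=
    div_neg_of_pos_of_neg (mul_self_pos.mpr hf') (mul_neg_of_neg_of_pos ha' hb')
  nlinarith

theorem eventually_exists_ringHom_extends {R Q L C : Type*} [CommRing R] [IsDomain R] [Field Q]
    [Field L] [Algebra R Q] [IsFractionRing R Q] [Algebra Q L] [Algebra R L] [IsScalarTower R Q L]
    [FiniteDimensional Q L] [CharZero Q] (σ₀ : L →+* ℝ) (l : Filter C) (τ : C → R →+* ℝ)
    (hτ : ∀ r, Filter.Tendsto (fun c => τ c r) l (nhds (σ₀ (algebraMap R L r)))) :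
    ∀ᶠ c in l, Function.Injective (τ c) → ∃ σ : L →+* ℝ, σ.comp (algebraMap R L) = τ c := by
  set θ := (Field.powerBasisOfFiniteOfSeparable Q L).gen with hθ
  set p := minpoly Q θ with hp
  obtain ⟨b, hbm, hb⟩ := IsLocalization.integerNormalization_spec (nonZeroDivisors R) p
  set g := IsLocalization.integerNormalization (nonZeroDivisors R) p with hg
  have hb' : g.map (algebraMap R Q) = Polynomial.C (algebraMap R Q b) * p := by
    rw [hb, ← Polynomial.smul_eq_C_mul, Algebra.smul_def, Polynomial.smul_eq_C_mul]; rfl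
  set τ₀ := σ₀.comp (algebraMap Q L) with hτ₀
  have hb0 : algebraMap R Q b ≠ 0 := IsFractionRing.to_map_ne_zero_of_mem_nonZeroDivisors hbm
  have hroot0 : (p.map τ₀).IsRoot (σ₀ θ) := by
    have h : Polynomial.aeval θ p = 0 := minpoly.aeval Q θ
    rw [Polynomial.IsRoot, Polynomial.eval_map, hτ₀, ← Polynomial.hom_eval₂, ← Polynomial.aeval_def,
      h, map_zero]
  have hsep : (p.map τ₀).Separable :=
    Polynomial.Separable.map (Algebra.IsSeparable.isSeparable Q θ)
  have hgmap : g.map (σ₀.comp (algebraMap R L)) =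
      Polynomial.C (τ₀ (algebraMap R Q b)) * p.map τ₀ := by
    rw [IsScalarTower.algebraMap_eq R Q L, ← RingHom.comp_assoc, ← Polynomial.map_map, hb',
      Polynomial.map_mul, Polynomial.map_C]
  obtain ⟨x₁, x₂, h12⟩ := exists_mul_neg_of_hasDerivAt
    ((g.map (σ₀.comp (algebraMap R L))).hasDerivAt (σ₀ θ)) (by
      rw [hgmap, Polynomial.eval_mul, hroot0.eq_zero, mul_zero]) (by
      rw [hgmap, Polynomial.derivative_C_mul, Polynomial.eval_mul, Polynomial.eval_C]
      exact mul_ne_zero (by simp [hb0]) (by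
        have := Polynomial.Separable.eval₂_derivative_ne_zero (RingHom.id ℝ) hsep (x := σ₀ θ) hroot0
        simpa using this))
  have hcont : ∀ x, Filter.Tendsto (fun c => g.eval₂ (τ c) x) l
      (nhds ((g.map (σ₀.comp (algebraMap R L))).eval x)) := by
    intro x
    simp only [Polynomial.eval_map, Polynomial.eval₂_eq_sum_range]
    exact tendsto_finsetSum _ fun i _ => (hτ _).mul_const _
  filter_upwards [((hcont x₁).mul (hcont x₂)).eventually (gt_mem_nhds h12)] with c hc hinj
  obtain ⟨r, hr⟩ : ∃ r, g.eval₂ (τ c) r = 0 := by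
    have hco : Continuous fun x => g.eval₂ (τ c) x := by
      simp only [← Polynomial.eval_map]; exact Polynomial.continuous _
    rcases mul_neg_iff.mp hc with ⟨h1, h2⟩ | ⟨h1, h2⟩
    · exact mem_range_of_exists_le_of_exists_ge hco ⟨_, h2.le⟩ ⟨_, h1.le⟩
    · exact mem_range_of_exists_le_of_exists_ge hco ⟨_, h1.le⟩ ⟨_, h2.le⟩
  let τ' : Q →+* ℝ := IsFractionRing.lift hinj
  have hτ' : τ'.comp (algebraMap R Q) = τ c := by
    ext r; exact IsFractionRing.lift_algebraMap hinj r
  obtain ⟨σ, h1, -⟩ := exists_ringHom_extends (L := L) τ' r (by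
    have : (g.map (algebraMap R Q)).eval₂ τ' r = 0 := by
      rw [Polynomial.eval₂_map, hτ', hr]
    rw [hb', Polynomial.eval₂_mul, Polynomial.eval₂_C] at this
    exact (mul_eq_zero.mp this).resolve_left (by simp [hb0]))
  refine ⟨σ, ?_⟩
  rw [IsScalarTower.algebraMap_eq R Q L, ← RingHom.comp_assoc, h1, hτ']

theorem MvPolynomial.countable_of_countable (ι k : Type*) [Countable ι] [CommSemiring k]
    [Countable k] : Countable (MvPolynomial ι k) := by
  rw [← Cardinal.mk_le_aleph0_iff]
  refine (MvPolynomial.cardinalMk_le_max_lift (σ := ι) (R := k)).trans ?_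
  simp [Cardinal.mk_le_aleph0]

/-- Nonzeros of a nonzero real polynomial are dense. -/
theorem dense_eval_ne_zero {ι : Type*} [Finite ι] {Q : MvPolynomial ι ℝ} (hQ : Q ≠ 0) :
    Dense {x : ι → ℝ | eval x Q ≠ 0} := by
  have := Fintype.ofFinite ι
  suffices h : interior {x : ι → ℝ | eval x Q = 0} = ∅ from
    interior_eq_empty_iff_dense_compl.mp h
  by_contra hne
  obtain ⟨x, hx⟩ := Set.nonempty_iff_ne_empty.mpr hne
  obtain ⟨ε, hε, hball⟩ := Metric.isOpen_iff.mp isOpen_interior x hx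
  apply hQ
  refine MvPolynomial.funext_set (fun i => Metric.ball (x i) ε) (fun i => ?_) fun y hy => ?_
  · rw [Real.ball_eq_Ioo]
    exact Set.Ioo_infinite (by linarith)
  · have : y ∈ Metric.ball x ε := by
      rw [ball_pi x hε]; exact hy
    simpa using interior_subset (hball this)

/-- Over a countable field, algebraically independent tuples of reals are dense. -/
theorem dense_algebraicIndependent (k : Type*) [Field k] [Countable k] [Algebra k ℝ]
    (ι : Type*) [Finite ι] : Dense {x : ι → ℝ | AlgebraicIndependent k x} := by
  have := Fintype.ofFinite ι
  have := MvPolynomial.countable_of_countable ι k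
  have h : {x : ι → ℝ | AlgebraicIndependent k x} =
      ⋂ Q : {Q : MvPolynomial ι k // Q ≠ 0}, {x | aeval x Q.1 ≠ 0} := by
    ext x
    simp only [Set.mem_ofPred_eq, Set.mem_iInter, Subtype.forall, algebraicIndependent_iff]
    exact forall_congr' fun Q => by tauto
  have he : ∀ (x : ι → ℝ) (Q : MvPolynomial ι k),
      aeval x Q = eval x (MvPolynomial.map (algebraMap k ℝ) Q) := fun x Q => by
    rw [eval_map, aeval_def]
  rw [h]
  refine dense_iInter_of_isOpen (fun Q => ?_) fun Q => ?_
  · simp only [he]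
    exact isOpen_ne.preimage (MvPolynomial.continuous_eval _)
  · simp only [he]
    exact dense_eval_ne_zero ((map_ne_zero_iff _
      (MvPolynomial.map_injective _ (algebraMap k ℝ).injective)).mpr Q.2)

open scoped IntermediateField.algebraAdjoinAdjoin in
/-- A finitely generated field extension `L` of a countable field `K` with a real embedding which is
determined by its restriction to `K` is algebraic. -/
theorem isAlgebraic_of_unique_ringHom {K L : Type*} [Field K] [Field L] [CharZero K] [Countable K]
    [Algebra K L] [Algebra.EssFiniteType K L] (σ₀ : L →+* ℝ)
    (huniq : ∀ σ : L →+* ℝ, σ.comp (algebraMap K L) = σ₀.comp (algebraMap K L) → σ = σ₀) :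
    Algebra.IsAlgebraic K L := by
  obtain ⟨s, hs, hsep⟩ := exists_isTranscendenceBasis_and_isSeparable_of_perfectField K L
  by_contra hna
  have hne : Nonempty s := by
    rw [← not_isEmpty_iff, hs.isEmpty_iff_isAlgebraic]; exact hna
  let := (σ₀.comp (algebraMap K L)).toAlgebra
  let b : s → L := (↑)
  have hb : AlgebraicIndependent K b := hs.1
  let R := Algebra.adjoin K (Set.range b)
  let Q := IntermediateField.adjoin K (Set.range b)
  have : Algebra.IsAlgebraic Q L := hs.isAlgebraic_field
  have : Algebra.EssFiniteType Q L := .of_comp K Q L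
  have : FiniteDimensional Q L := Algebra.finite_of_essFiniteType_of_isAlgebraic
  let τ : (s → ℝ) → R →+* ℝ := fun c => (aeval (R := K) c).toRingHom.comp
    (hb.aevalEquiv.symm : R ≃+* _).toRingHom
  have hτ : ∀ c P, τ c (hb.aevalEquiv P) = aeval c P := fun c P => by simp [τ]
  have hev := eventually_exists_ringHom_extends (R := R) (Q := Q) (L := L) σ₀
    (nhds (fun i => σ₀ (b i))) τ (by
      intro r
      obtain ⟨P, rfl⟩ := hb.aevalEquiv.surjective r
      simp only [hτ]
      have h1 : σ₀ (algebraMap R L (hb.aevalEquiv P)) = aeval (fun i => σ₀ (b i)) P := by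
        rw [hb.algebraMap_aevalEquiv, aeval_def, aeval_def, MvPolynomial.hom_eval₂]; rfl
      rw [h1]
      simp only [aeval_def, ← eval_map]
      exact (MvPolynomial.continuous_eval _).tendsto _)
  have hfr := (dense_algebraicIndependent K s).sdiff_singleton (fun i => σ₀ (b i))
  obtain ⟨c, ⟨hc, hc'⟩, hcσ⟩ := ((mem_closure_iff_frequently.mp (hfr _)).and_eventually hev).exists
  obtain ⟨σ, hσ⟩ := hcσ (by
    have : Function.Injective (aeval (R := K) c) := hc
    exact this.comp hb.aevalEquiv.symm.injective)
  apply hc'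
  have h1 : σ = σ₀ := huniq σ (by
    ext x
    have := RingHom.congr_fun hσ (algebraMap K R x)
    simp only [RingHom.comp_apply, ← IsScalarTower.algebraMap_apply K R L] at this ⊢
    rw [this, ← AlgEquiv.commutes hb.aevalEquiv, hτ, AlgHom.commutes]; rfl)
  funext i
  have := RingHom.congr_fun hσ (hb.aevalEquiv (X i))
  rw [hτ, aeval_X, RingHom.comp_apply, hb.algebraMap_aevalEquiv, aeval_X, h1] at this
  exact this.symm

/-- Two tuples have the same type over `k` if they satisfy the same polynomial equations. -/
def SameType (k : Type*) [Field k] [Algebra k ℝ] {κ : Type*} (y y' : κ → ℝ) : Prop :=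
  ∀ Q : MvPolynomial κ k, aeval y Q = 0 ↔ aeval y' Q = 0

namespace SameType
variable {k : Type*} [Field k] [Algebra k ℝ] {κ : Type*} {y y' : κ → ℝ}

theorem symm (h : SameType k y y') : SameType k y' y := fun Q => (h Q).symm

theorem of_algebraicIndependent (h : AlgebraicIndependent k y) (h' : AlgebraicIndependent k y') :
    SameType k y y' := fun Q => by
  rw [algebraicIndependent_iff] at h h'
  exact ⟨fun hQ => by rw [h Q hQ, map_zero], fun hQ => by rw [h' Q hQ, map_zero]⟩

open scoped IntermediateField.algebraAdjoinAdjoin in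
theorem exists_ringHom (h : SameType k y y') :
    ∃ τ : IntermediateField.adjoin k (Set.range y) →+* ℝ, ∀ Q : MvPolynomial κ k,
      ∀ z : IntermediateField.adjoin k (Set.range y), (z : ℝ) = aeval y Q → τ z = aeval y' Q := by
  have hmem : ∀ Q : MvPolynomial κ k, aeval y Q ∈ Algebra.adjoin k (Set.range y) := fun Q => by
    rw [Algebra.adjoin_range_eq_range_aeval]; exact ⟨Q, rfl⟩
  let f : MvPolynomial κ k →+* Algebra.adjoin k (Set.range y) :=
    ((aeval (R := k) y).codRestrict _ hmem).toRingHom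
  have hf : Function.Surjective f := by
    rintro ⟨z, hz⟩
    rw [Algebra.adjoin_range_eq_range_aeval] at hz
    obtain ⟨Q, hQ⟩ := hz
    exact ⟨Q, Subtype.ext hQ⟩
  have hker : ∀ Q, f Q = 0 ↔ aeval y Q = 0 := fun Q => by
    rw [← Subtype.coe_inj]; rfl
  let g := f.liftOfSurjective hf ⟨(aeval (R := k) y').toRingHom, fun Q hQ => by
    rw [RingHom.mem_ker, hker, h Q] at hQ
    simpa [RingHom.mem_ker] using hQ⟩
  have hg : ∀ Q, g (f Q) = aeval y' Q := fun Q => by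
    simp [g, RingHom.liftOfRightInverse_comp_apply]
  have hinj : Function.Injective g := by
    rw [injective_iff_map_eq_zero]
    intro a ha
    obtain ⟨Q, rfl⟩ := hf a
    rwa [hg, ← h Q, ← hker] at ha
  refine ⟨IsFractionRing.lift hinj, fun Q z hz => ?_⟩
  have : z = algebraMap _ _ (f Q) := Subtype.ext hz
  rw [this, IsFractionRing.lift_algebraMap, hg]

end SameType

section
variable {k : Type*} [Field k] [Countable k] [Algebra k ℝ] {κ ι : Type*} [Finite κ] [Finite ι]
  {y : κ → ℝ} {x : ι → ℝ}

theorem countable_adjoin_range (y : κ → ℝ) :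
    Countable (IntermediateField.adjoin k (Set.range y)) := by
  rw [← Cardinal.mk_le_aleph0_iff]
  have h := IntermediateField.lift_cardinalMk_adjoin_le k (Set.range y)
  rw [← Cardinal.lift_le_aleph0]
  refine h.trans ?_
  simp [Cardinal.mk_le_aleph0]

variable (k y x) in
/-- The field `k(y)(x)` as an extension of `k(y)`. -/
noncomputable abbrev adjoinTower : IntermediateField (IntermediateField.adjoin k (Set.range y)) ℝ :=
  IntermediateField.adjoin (IntermediateField.adjoin k (Set.range y)) (Set.range x)

variable (k y x) in
/-- The tuple `(y, x)` viewed inside the field it generates. -/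
noncomputable def towerPoint : κ ⊕ ι → adjoinTower k y x :=
  Sum.elim (fun j => algebraMap (IntermediateField.adjoin k (Set.range y)) _
    ⟨y j, IntermediateField.subset_adjoin _ _ ⟨j, rfl⟩⟩)
    fun i => ⟨x i, IntermediateField.subset_adjoin _ _ ⟨i, rfl⟩⟩

omit [Countable k] [Finite κ] [Finite ι] in
theorem coe_aeval_towerPoint (Q : MvPolynomial (κ ⊕ ι) k) :
    ((aeval (towerPoint k y x) Q : adjoinTower k y x) : ℝ) = aeval (Sum.elim y x) Q := by
  have h : (fun j => algebraMap (adjoinTower k y x) ℝ (towerPoint k y x j)) = Sum.elim y x := by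
    funext j; cases j <;> rfl
  have : IsScalarTower k (adjoinTower k y x) ℝ := IsScalarTower.of_algebraMap_eq fun _ => rfl
  rw [← h]
  exact (aeval_algebraMap_apply ℝ (towerPoint k y x) Q).symm

omit [Countable k] [Finite κ] [Finite ι] in
theorem ringHom_aeval_towerPoint {y' : κ → ℝ} (σ : adjoinTower k y x →+* ℝ)
    (hσ : ∀ a : k, σ (algebraMap _ _ a) = algebraMap k ℝ a)
    (hy : ∀ j, σ (towerPoint k y x (Sum.inl j)) = y' j) (Q : MvPolynomial (κ ⊕ ι) k) :
    σ (aeval (towerPoint k y x) Q) =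
      aeval (Sum.elim y' fun i => σ (towerPoint k y x (Sum.inr i))) Q := by
  have h : (fun j => σ (towerPoint k y x j)) =
      Sum.elim y' fun i => σ (towerPoint k y x (Sum.inr i)) := by
    funext j
    cases j
    · exact hy _
    · rfl
  have h2 : σ.comp (algebraMap k (adjoinTower k y x)) = algebraMap k ℝ := RingHom.ext hσ
  rw [aeval_def, MvPolynomial.hom_eval₂, h2, aeval_def, ← h]

omit [Countable k] [Finite κ] [Finite ι] in
theorem unique_ringHom_of_unique_point
    (huniq : ∀ x' : ι → ℝ, (∀ Q : MvPolynomial (κ ⊕ ι) k, aeval (Sum.elim y x) Q = 0 →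
      aeval (Sum.elim y x') Q = 0) → x' = x)
    (σ : adjoinTower k y x →+* ℝ)
    (hσ : σ.comp (algebraMap (IntermediateField.adjoin k (Set.range y)) _) =
      (algebraMap (adjoinTower k y x) ℝ).comp (algebraMap
        (IntermediateField.adjoin k (Set.range y)) _)) : σ = algebraMap _ ℝ := by
  have hx := huniq (fun i => σ (towerPoint k y x (Sum.inr i))) (fun Q hQ => by
    rw [← coe_aeval_towerPoint] at hQ
    rw [← ringHom_aeval_towerPoint σ]
    · rw [show aeval (towerPoint k y x) Q = 0 from Subtype.ext hQ, map_zero]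
    · exact fun a => RingHom.congr_fun hσ (algebraMap _ _ a)
    · exact fun j => RingHom.congr_fun hσ _)
  let σ' : adjoinTower k y x →ₐ[IntermediateField.adjoin k (Set.range y)] ℝ :=
    { σ with commutes' := fun a => RingHom.congr_fun hσ a }
  have : σ' = (adjoinTower k y x).val :=
    IntermediateField.algHom_ext_of_eq_adjoin _ rfl (by
      rintro _ ⟨i, rfl⟩
      exact congrFun hx i)
  ext a
  exact DFunLike.congr_fun this a

theorem isAlgebraic_adjoinTower
    (huniq : ∀ x' : ι → ℝ, (∀ Q : MvPolynomial (κ ⊕ ι) k, aeval (Sum.elim y x) Q = 0 →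
      aeval (Sum.elim y x') Q = 0) → x' = x) :
    FiniteDimensional (IntermediateField.adjoin k (Set.range y)) (adjoinTower k y x) := by
  have := countable_adjoin_range (k := k) y
  have : Algebra.EssFiniteType (IntermediateField.adjoin k (Set.range y)) (adjoinTower k y x) :=
    IntermediateField.essFiniteType_iff.mpr
      (IntermediateField.fg_adjoin_of_finite (Set.finite_range x))
  have := isAlgebraic_of_unique_ringHom (K := IntermediateField.adjoin k (Set.range y))
    (algebraMap (adjoinTower k y x) ℝ) (unique_ringHom_of_unique_point huniq)
  exact Algebra.finite_of_essFiniteType_of_isAlgebraic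

/-- If `x` is the only real solution of the algebraic relations of `x` over `k(y)`, then `x` is
algebraic over `k(y)`. -/
theorem isAlgebraic_of_unique_point
    (huniq : ∀ x' : ι → ℝ, (∀ Q : MvPolynomial (κ ⊕ ι) k, aeval (Sum.elim y x) Q = 0 →
      aeval (Sum.elim y x') Q = 0) → x' = x) (i : ι) :
    IsAlgebraic (IntermediateField.adjoin k (Set.range y)) (x i) := by
  have := isAlgebraic_adjoinTower huniq
  exact (Algebra.IsAlgebraic.isAlgebraic (towerPoint k y x (Sum.inr i))).algebraMap (A := ℝ)

/-- If `x` is the only real solution of the algebraic relations of `x` over `k(y)`, then such a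
solution exists for any tuple of the same type as `y`. -/
theorem exists_sameType_of_unique_point
    (huniq : ∀ x' : ι → ℝ, (∀ Q : MvPolynomial (κ ⊕ ι) k, aeval (Sum.elim y x) Q = 0 →
      aeval (Sum.elim y x') Q = 0) → x' = x) {y' : κ → ℝ} (hy : SameType k y y') :
    ∃ x' : ι → ℝ, SameType k (Sum.elim y x) (Sum.elim y' x') := by
  have := isAlgebraic_adjoinTower huniq
  obtain ⟨τ, hτ⟩ := hy.exists_ringHom
  obtain ⟨σ, hσ⟩ := exists_ringHom_extends_of_unique (algebraMap (adjoinTower k y x) ℝ)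
    (unique_ringHom_of_unique_point huniq) τ
  refine ⟨fun i => σ (towerPoint k y x (Sum.inr i)), fun Q => ?_⟩
  rw [← ringHom_aeval_towerPoint σ, ← coe_aeval_towerPoint]
  · rw [map_eq_zero]
    norm_cast
  · intro a
    have := RingHom.congr_fun hσ (algebraMap _ _ a)
    rw [RingHom.comp_apply, hτ (C a)] at this
    · rw [aeval_C] at this; exact this
    · rw [aeval_C]; rfl
  · intro j
    have := RingHom.congr_fun hσ ⟨y j, IntermediateField.subset_adjoin _ _ ⟨j, rfl⟩⟩
    rw [hτ (X j)] at this
    · rw [aeval_X] at this; exact this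
    · rw [aeval_X]

end

section
variable {k : Type*} [Field k] [Algebra k ℝ] {ι : Type*}

open scoped IntermediateField.algebraAdjoinAdjoin TensorProduct in
/-- Derivations of `ℝ` over a field take arbitrary values on algebraically independent numbers. -/
theorem exists_derivation_of_algebraicIndependent [CharZero k] {a : ι → ℝ}
    (ha : AlgebraicIndependent k a) (v : ι → ℝ) : ∃ D : Derivation k ℝ ℝ, ∀ i, D (a i) = v i := by
  obtain ⟨t, hst, ht⟩ := exists_isTranscendenceBasis_superset (R := k) (s := Set.range a)
    ((algebraicIndependent_subtype_range ha.injective).mpr ha)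
  let b : t → ℝ := (↑)
  have hb : AlgebraicIndependent k b := ht.1
  let S := MvPolynomial t k
  let R := Algebra.adjoin k (Set.range b)
  let Q := IntermediateField.adjoin k (Set.range b)
  let : Algebra S R := hb.aevalEquiv.toAlgHom.toAlgebra
  let : Algebra S ℝ := (aeval (R := k) b).toAlgebra
  have : IsScalarTower S R ℝ := IsScalarTower.of_algebraMap_eq fun x => rfl
  have : IsScalarTower k S ℝ := IsScalarTower.of_algebraMap_eq fun x => by
    exact ((aeval (R := k) b).commutes x).symm
  have : Algebra.IsAlgebraic Q ℝ := ht.isAlgebraic_field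
  have : Algebra.FormallyEtale S R :=
    .of_equiv (R := S) (A := S) (AlgEquiv.ofBijective (Algebra.ofId S R) hb.aevalEquiv.bijective)
  have : Algebra.FormallyEtale R Q := .of_isLocalization (nonZeroDivisors R)
  have : Algebra.FormallyEtale Q ℝ := .of_isSeparable _ _
  have : Algebra.FormallyEtale R ℝ := .comp R Q ℝ
  have : Algebra.FormallyEtale S ℝ := .comp S R ℝ
  let w : t → ℝ := fun j => Function.extend a v 0 j
  let D₀ : Derivation k S ℝ := mkDerivation k w
  let φ : ℝ ⊗[S] Ω[S⁄k] →ₗ[ℝ] ℝ := LinearMap.liftBaseChange ℝ D₀.liftKaehlerDifferential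
  let ψ : Ω[ℝ⁄k] →ₗ[ℝ] ℝ := φ ∘ₗ
    (KaehlerDifferential.tensorKaehlerEquivOfFormallyEtale k S ℝ).symm.toLinearMap
  refine ⟨ψ.compDer (KaehlerDifferential.D k ℝ), fun i => ?_⟩
  have hi : a i = algebraMap S ℝ (X ⟨a i, hst ⟨i, rfl⟩⟩) := (aeval_X b ⟨a i, hst ⟨i, rfl⟩⟩).symm
  have : ψ (KaehlerDifferential.D k ℝ (algebraMap S ℝ (X ⟨a i, hst ⟨i, rfl⟩⟩))) =
      D₀ (X ⟨a i, hst ⟨i, rfl⟩⟩) := by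
    simp only [ψ, LinearMap.comp_apply, LinearEquiv.coe_coe,
      KaehlerDifferential.tensorKaehlerEquivOfFormallyEtale_symm_D_algebraMap, φ,
      LinearMap.liftBaseChange_tmul, Derivation.liftKaehlerDifferential_comp_D, one_smul]
  refine (congrArg (ψ.compDer (KaehlerDifferential.D k ℝ)) hi).trans (this.trans ?_)
  refine (mkDerivation_X k w _).trans ?_
  exact ha.injective.extend_apply v 0 i

variable [Fintype ι]

theorem Derivation.map_aeval_mvPolynomial (D : Derivation k ℝ ℝ) (x : ι → ℝ)
    (P : MvPolynomial ι k) :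
    D (aeval x P) = ∑ j, aeval x (pderiv j P) * D (x j) := by
  classical
  induction P using MvPolynomial.induction_on with
  | C a => simp
  | add p q hp hq => simp [hp, hq, add_mul, Finset.sum_add_distrib]
  | mul_X p i hp =>
    simp only [map_mul, aeval_X, Derivation.leibniz, hp, smul_eq_mul, pderiv_X, map_add, add_mul,
      Finset.sum_add_distrib, Finset.mul_sum]
    congr 1
    · simp [Pi.single_apply, apply_ite (aeval x)]
    · exact Finset.sum_congr rfl fun j _ => by ring

/-- The differential of the polynomial function `P` at `x`. -/
noncomputable def MvPolynomial.fderivAt (P : MvPolynomial ι k) (x : ι → ℝ) : (ι → ℝ) →L[ℝ] ℝ :=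
  ∑ j, aeval x (pderiv j P) • ContinuousLinearMap.proj j

theorem MvPolynomial.fderivAt_apply (P : MvPolynomial ι k) (x v : ι → ℝ) :
    P.fderivAt x v = ∑ j, aeval x (pderiv j P) * v j := by
  simp [fderivAt]

theorem MvPolynomial.hasStrictFDerivAt_aeval (P : MvPolynomial ι k) (x : ι → ℝ) :
    HasStrictFDerivAt (fun y => aeval y P) (P.fderivAt x) x := by
  classical
  induction P using MvPolynomial.induction_on with
  | C a =>
    simp only [aeval_C, fderivAt, pderiv_C, map_zero, zero_smul, Finset.sum_const_zero]
    exact hasStrictFDerivAt_const _ _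
  | add p q hp hq =>
    simp only [map_add]
    refine (hp.add hq).congr_fderiv ?_
    ext v
    simp [fderivAt_apply, add_mul, Finset.sum_add_distrib]
  | mul_X p i hp =>
    simp only [map_mul, aeval_X]
    refine (hp.mul (ContinuousLinearMap.proj i : (ι → ℝ) →L[ℝ] ℝ).hasStrictFDerivAt).congr_fderiv ?_
    ext v
    simp only [add_apply, smul_apply, fderivAt_apply,
      smul_eq_mul, ContinuousLinearMap.proj_apply, Derivation.leibniz, map_add, map_mul, aeval_X,
      pderiv_X, add_mul, Finset.sum_add_distrib, Finset.mul_sum]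
    congr 1
    · simp [Pi.single_apply, apply_ite (aeval x)]
    · exact Finset.sum_congr rfl fun j _ => by ring

theorem MvPolynomial.continuous_aeval (P : MvPolynomial ι k) :
    Continuous fun x : ι → ℝ => aeval x P :=
  continuous_iff_continuousAt.mpr fun x => (P.hasStrictFDerivAt_aeval x).continuousAt

theorem Derivation.map_aeval_eq_fderivAt (D : Derivation k ℝ ℝ) (x : ι → ℝ)
    (P : MvPolynomial ι k) : D (aeval x P) = P.fderivAt x fun j => D (x j) := by
  rw [D.map_aeval_mvPolynomial, fderivAt_apply]

omit [Fintype ι] in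
theorem Derivation.map_eq_zero_of_isAlgebraic_base [CharZero k] (D : Derivation k ℝ ℝ) {z : ℝ}
    (hz : IsAlgebraic k z) : D z = 0 := by
  have h := D.map_aeval (minpoly k z) z
  rw [minpoly.aeval, map_zero, smul_eq_mul, eq_comm, mul_eq_zero] at h
  exact h.resolve_left (Polynomial.Separable.aeval_derivative_ne_zero
    (minpoly.irreducible hz.isIntegral).separable (minpoly.aeval k z))

/-- A derivation killing `y` kills everything algebraic over `k(y)`. -/
theorem Derivation.map_eq_zero_of_isAlgebraic {κ : Type*} [CharZero k] (D : Derivation k ℝ ℝ)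
    {y : κ → ℝ} (hy : ∀ j, D (y j) = 0) {z : ℝ}
    (hz : IsAlgebraic (IntermediateField.adjoin k (Set.range y)) z) : D z = 0 := by
  have hK : ∀ w ∈ IntermediateField.adjoin k (Set.range y), D w = 0 := by
    intro w hw
    induction hw using IntermediateField.adjoin_induction with
    | mem x hx => obtain ⟨j, rfl⟩ := hx; exact hy j
    | algebraMap x => exact D.map_algebraMap x
    | add x y _ _ hx hy => simp [hx, hy]
    | inv x _ hx => simp [Derivation.leibniz_inv, hx]
    | mul x y _ _ hx hy => simp [hx, hy]
  let D' : Derivation (IntermediateField.adjoin k (Set.range y)) ℝ ℝ :=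
    Derivation.mk'
      { toFun := D
        map_add' := map_add D
        map_smul' := fun c x => by simp [Algebra.smul_def, hK c.1 c.2] }
      fun a b => by simp
  exact D'.map_eq_zero_of_isAlgebraic_base hz
end

section
open Filter Topology Set

/-- The map of affine spaces given by a tuple of polynomials. -/
noncomputable def polyMap {k : Type*} [Field k] [Algebra k ℝ] {κ ι : Type*}
    (F : κ → MvPolynomial ι k) : (ι → ℝ) → κ → ℝ := fun x i => aeval x (F i)

section
variable {k : Type*} [Field k] [Algebra k ℝ] {κ ι : Type*} [Fintype κ] [Fintype ι]

/-- The differential of a polynomial map. -/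
noncomputable def polyMapDeriv (F : κ → MvPolynomial ι k) (x : ι → ℝ) : (ι → ℝ) →L[ℝ] (κ → ℝ) :=
  ContinuousLinearMap.pi fun i => (F i).fderivAt x

omit [Fintype κ] in
theorem hasStrictFDerivAt_polyMap (F : κ → MvPolynomial ι k) (x : ι → ℝ) :
    HasStrictFDerivAt (polyMap F) (polyMapDeriv F x) x :=
  hasStrictFDerivAt_pi'.mpr fun i => (F i).hasStrictFDerivAt_aeval x

omit [Fintype κ] in
theorem continuous_polyMap (F : κ → MvPolynomial ι k) : Continuous (polyMap F) :=
  continuous_pi fun i => (F i).continuous_aeval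

omit [Fintype κ] in
theorem polyMapDeriv_surjective [CharZero k] (F : κ → MvPolynomial ι k) {x : ι → ℝ}
    (h : AlgebraicIndependent k (polyMap F x)) : Function.Surjective (polyMapDeriv F x) := by
  intro v
  obtain ⟨D, hD⟩ := exists_derivation_of_algebraicIndependent h v
  refine ⟨fun j => D (x j), funext fun i => ?_⟩
  rw [← hD i]
  exact (D.map_aeval_eq_fderivAt x (F i)).symm

omit [Fintype κ] [Fintype ι] in
theorem aeval_graph_relation (F : κ → MvPolynomial ι k) (y : κ → ℝ) (x : ι → ℝ) (i : κ) :
    aeval (Sum.elim y x) (X (Sum.inl i) - rename Sum.inr (F i) : MvPolynomial (κ ⊕ ι) k) =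
      y i - polyMap F x i := by
  simp [aeval_rename, polyMap]

omit [Fintype κ] [Fintype ι] in
theorem unique_point_of_injective {F : κ → MvPolynomial ι k} (hF : Function.Injective (polyMap F))
    (x x' : ι → ℝ) (h : ∀ Q : MvPolynomial (κ ⊕ ι) k, aeval (Sum.elim (polyMap F x) x) Q = 0 →
      aeval (Sum.elim (polyMap F x) x') Q = 0) : x' = x := by
  refine hF (funext fun i => ?_)
  have := h (X (Sum.inl i) - rename Sum.inr (F i)) (by rw [aeval_graph_relation, sub_self])
  rw [aeval_graph_relation, sub_eq_zero] at this
  exact this.symm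

variable [Countable k]

theorem isAlgebraic_of_injective_polyMap {F : κ → MvPolynomial ι k}
    (hF : Function.Injective (polyMap F)) (x : ι → ℝ) (i : ι) :
    IsAlgebraic (IntermediateField.adjoin k (Set.range (polyMap F x))) (x i) :=
  isAlgebraic_of_unique_point (unique_point_of_injective hF x) i

theorem SameType.mem_range_polyMap {F : κ → MvPolynomial ι k}
    (hF : Function.Injective (polyMap F)) {y y' : κ → ℝ} (h : SameType k y y')
    (hy : y ∈ range (polyMap F)) : y' ∈ range (polyMap F) := by
  obtain ⟨x, rfl⟩ := hy
  obtain ⟨x', hx'⟩ := exists_sameType_of_unique_point (unique_point_of_injective hF x) h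
  refine ⟨x', funext fun i => ?_⟩
  have := (hx' (X (Sum.inl i) - rename Sum.inr (F i))).mp (by rw [aeval_graph_relation, sub_self])
  rw [aeval_graph_relation, sub_eq_zero] at this
  exact this.symm

theorem polyMapDeriv_injective [CharZero k] {F : κ → MvPolynomial ι k}
    (hF : Function.Injective (polyMap F)) {x : ι → ℝ} (hx : AlgebraicIndependent k x) :
    Function.Injective (polyMapDeriv F x) := by
  rw [injective_iff_map_eq_zero]
  intro v hv
  obtain ⟨D, hD⟩ := exists_derivation_of_algebraicIndependent hx v
  funext i
  rw [← hD i]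
  refine D.map_eq_zero_of_isAlgebraic (fun j => ?_) (isAlgebraic_of_injective_polyMap hF x i)
  refine (D.map_aeval_eq_fderivAt x (F j)).trans ?_
  rw [funext hD]
  exact congrFun hv j

/-- An injective continuous function of one variable is open. -/
theorem Continuous.image_mem_nhds_of_injOn {h : ℝ → ℝ} {r : ℝ} (hr : 0 < r)
    (hc : ContinuousOn h (Icc (-r) r)) (hi : InjOn h (Icc (-r) r)) :
    h '' Icc (-r) r ∈ 𝓝 (h 0) := by
  have h0 : (0 : ℝ) ∈ Icc (-r) r := ⟨by linarith, hr.le⟩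
  have hl : -r ∈ Icc (-r) r := ⟨le_rfl, by linarith⟩
  have hR : r ∈ Icc (-r) r := ⟨by linarith, le_rfl⟩
  rcases hc.strictMonoOn_of_injOn_Icc' (by linarith) hi with hm | hm
  · exact mem_of_superset (Icc_mem_nhds (hm hl h0 (by linarith)) (hm h0 hR hr))
      (intermediate_value_Icc (by linarith) hc)
  · exact mem_of_superset (Icc_mem_nhds (hm h0 hR hr) (hm hl h0 (by linarith)))
      (intermediate_value_Icc' (by linarith) hc)

variable [DecidableEq ι]

omit [Countable k] in
/-- Moving one coordinate of the value of an injective polynomial map. -/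
theorem eventually_update_mem_image [CharZero k] {F : ι → MvPolynomial ι k}
    (hF : Function.Injective (polyMap F)) {x : ι → ℝ} (j : ι)
    (hx : AlgebraicIndependent k fun i : {i // i ≠ j} => polyMap F x i)
    {s : Set (ι → ℝ)} (hs : s ∈ 𝓝 x) :
    ∀ᶠ r in 𝓝 (polyMap F x j), Function.update (polyMap F x) j r ∈ polyMap F '' s := by
  let P : {i // i ≠ j} → MvPolynomial ι k := fun i => F i
  have hf := hasStrictFDerivAt_polyMap P x
  have hf' : (polyMapDeriv P x).range = ⊤ := LinearMap.range_eq_top.mpr (polyMapDeriv_surjective P hx)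
  obtain ⟨v, hv, hv0⟩ := Submodule.exists_mem_ne_zero_of_ne_bot
    (LinearMap.ker_ne_bot_of_finrank_lt (f := (polyMapDeriv P x).toLinearMap) (by
      simp only [Module.finrank_fintype_fun_eq_card]
      exact Fintype.card_subtype_lt (x := j) (by simp)))
  let φ := hf.implicitToOpenPartialHomeomorph (polyMap P) (polyMapDeriv P x) hf'
  let w : (polyMapDeriv P x).ker := ⟨v, hv⟩
  have hw0 : w ≠ 0 := fun h => hv0 (congrArg Subtype.val h)
  let g : ℝ → ({i // i ≠ j} → ℝ) × (polyMapDeriv P x).ker := fun u => (polyMap P x, u • w)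
  have hg : Continuous g := by fun_prop
  have hg0 : g 0 = φ x := by
    simp only [g, zero_smul, φ]
    exact (hf.implicitToOpenPartialHomeomorph_self hf').symm
  have hxs : x ∈ φ.source := hf.mem_implicitToOpenPartialHomeomorph_source hf'
  have h1 : ∀ᶠ u in 𝓝 (0 : ℝ), g u ∈ φ.target := by
    refine hg.continuousAt.eventually (φ.open_target.mem_nhds ?_)
    rw [hg0]; exact φ.map_source hxs
  have h2 : ∀ᶠ u in 𝓝 (0 : ℝ), φ.symm (g u) ∈ s := by
    have : ContinuousAt (fun u => φ.symm (g u)) 0 := by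
      refine ContinuousAt.comp ?_ hg.continuousAt
      rw [hg0]
      exact φ.symm.continuousAt (φ.map_source hxs)
    refine this.eventually ?_
    have h3 : φ.symm (g 0) = x := by rw [hg0, φ.left_inv hxs]
    simp only [h3]
    exact hs
  obtain ⟨r, hr, hball⟩ := Metric.eventually_nhds_iff_ball.mp (h1.and h2)
  have hr2 : ∀ u ∈ Icc (-(r / 2)) (r / 2), u ∈ Metric.ball (0 : ℝ) r := fun u hu => by
    rw [mem_ball_zero_iff, Real.norm_eq_abs]
    exact (abs_le.mpr hu).trans_lt (by linarith)
  have hval : ∀ u ∈ Icc (-(r / 2)) (r / 2), polyMap F (φ.symm (g u)) =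
      Function.update (polyMap F x) j (polyMap F (φ.symm (g u)) j) := fun u hu => by
    have h3 := φ.right_inv (hball u (hr2 u hu)).1
    have h4 : polyMap P (φ.symm (g u)) = polyMap P x := by
      have := congrArg Prod.fst h3
      rwa [show (φ (φ.symm (g u))).1 = polyMap P (φ.symm (g u)) from
        hf.implicitToOpenPartialHomeomorph_fst hf' _] at this
    funext i
    by_cases hi : i = j
    · subst hi; simp
    · rw [Function.update_of_ne hi]
      exact congrFun h4 ⟨i, hi⟩
  let h : ℝ → ℝ := fun u => polyMap F (φ.symm (g u)) j
  have hc : ContinuousOn h (Icc (-(r / 2)) (r / 2)) := by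
    refine ((continuous_apply j).comp (continuous_polyMap F)).comp_continuousOn ?_
    exact φ.symm.continuousOn.comp hg.continuousOn fun u hu => (hball u (hr2 u hu)).1
  have hi : InjOn h (Icc (-(r / 2)) (r / 2)) := fun u hu u' hu' huu => by
    have h5 : polyMap F (φ.symm (g u)) = polyMap F (φ.symm (g u')) := by
      rw [hval u hu, hval u' hu']; exact congrArg _ huu
    have h6 := φ.symm.injOn (hball u (hr2 u hu)).1 (hball u' (hr2 u' hu')).1 (hF h5)
    exact smul_left_injective ℝ hw0 (congrArg Prod.snd h6)
  have hh0 : h 0 = polyMap F x j := by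
    simp only [h, hg0, φ.left_inv hxs]
  rw [← hh0]
  filter_upwards [Continuous.image_mem_nhds_of_injOn (half_pos hr) hc hi]
  rintro _ ⟨u, hu, rfl⟩
  exact ⟨_, (hball u (hr2 u hu)).2, hval u hu⟩
end

section
variable {k : Type*} [Field k] [Algebra k ℝ] {ι : Type*} [Fintype ι] [Countable k] [CharZero k]

theorem map_nhds_polyMap_of_algebraicIndependent {F : ι → MvPolynomial ι k}
    (hF : Function.Injective (polyMap F)) {x : ι → ℝ} (hx : AlgebraicIndependent k x) :
    map (polyMap F) (𝓝 x) = 𝓝 (polyMap F x) :=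
  (hasStrictFDerivAt_polyMap F x).map_nhds_eq_of_surj
    (LinearMap.range_eq_top.mpr (LinearMap.injective_iff_surjective.mp
      (polyMapDeriv_injective hF hx)))

omit [Countable k] in
theorem piecewise_mem_image_closedBall [DecidableEq ι] {F : ι → MvPolynomial ι k}
    (hF : Function.Injective (polyMap F)) {x₀ y₀ : ι → ℝ} {ε δ : ℝ}
    (hδ : ∀ x ∈ Metric.sphere x₀ ε, polyMap F x ∉ Metric.ball y₀ δ)
    {c : ι ⊕ ι → ℝ} (hc : AlgebraicIndependent k c) (h₁ : c ∘ Sum.inl ∈ Metric.ball y₀ δ)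
    (h₂ : c ∘ Sum.inr ∈ Metric.ball y₀ δ)
    (h : c ∘ Sum.inl ∈ polyMap F '' Metric.closedBall x₀ ε) (s : Finset ι) :
    s.piecewise (c ∘ Sum.inr) (c ∘ Sum.inl) ∈ polyMap F '' Metric.closedBall x₀ ε := by
  have hδ0 : 0 < δ := Metric.nonempty_ball.mp ⟨_, h₁⟩
  have hK : IsClosed (polyMap F '' Metric.closedBall x₀ ε) :=
    ((isCompact_closedBall x₀ ε).image (continuous_polyMap F)).isClosed
  induction s using Finset.induction_on with
  | empty => simpa using h
  | insert j s hj ih =>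
    set y := s.piecewise (c ∘ Sum.inr) (c ∘ Sum.inl) with hy
    rw [Finset.piecewise_insert]
    have hup : Continuous fun t => Function.update y j t := continuous_const.update j continuous_id
    let Λ := {t | Function.update y j t ∈ polyMap F '' Metric.closedBall x₀ ε}
    have hΛ : IsClosed Λ := hK.preimage hup
    have key : ∀ t ∈ uIcc (c (Sum.inl j)) (c (Sum.inr j)), t ∈ Λ → t ∈ interior Λ := by
      rintro t ht ⟨x, hx, hxt⟩
      have hball : polyMap F x ∈ Metric.ball y₀ δ := by
        rw [hxt, Metric.mem_ball, dist_pi_lt_iff hδ0]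
        rw [Metric.mem_ball, dist_pi_lt_iff hδ0] at h₁ h₂
        intro i
        by_cases hi : i = j
        · subst hi
          rw [Function.update_self]
          exact (convex_ball (y₀ i) δ).ordConnected.uIcc_subset (h₁ i) (h₂ i) ht
        · rw [Function.update_of_ne hi, hy]
          by_cases his : i ∈ s
          · rw [Finset.piecewise_eq_of_mem _ _ _ his]; exact h₂ i
          · rw [Finset.piecewise_eq_of_notMem _ _ _ his]; exact h₁ i
      have hxb : x ∈ Metric.ball x₀ ε := by
        refine lt_of_le_of_ne hx fun h => hδ x h hball
      have hgen : AlgebraicIndependent k fun i : {i // i ≠ j} => polyMap F x i := by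
        let e : {i // i ≠ j} → ι ⊕ ι := fun i => if i.1 ∈ s then Sum.inr i else Sum.inl i
        have he : Function.Injective e := by
          intro a b hab
          simp only [e] at hab
          split_ifs at hab <;> simpa [Subtype.ext_iff] using hab
        have := hc.comp e he
        convert this using 1
        funext i
        rw [hxt, Function.update_of_ne i.2]
        by_cases his : i.1 ∈ s <;> simp [e, his, hy]
      have := eventually_update_mem_image hF j hgen (Metric.isOpen_ball.mem_nhds hxb)
      rw [hxt] at this
      simp only [Function.update_idem, Function.update_self] at this
      rw [mem_interior_iff_mem_nhds]
      filter_upwards [this] with r hr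
      exact image_mono Metric.ball_subset_closedBall hr
    have hmem : c (Sum.inl j) ∈ Λ := by
      have : Function.update y j (c (Sum.inl j)) = y := by
        conv_rhs => rw [← Function.update_eq_self j y]
        rw [hy, Finset.piecewise_eq_of_notMem _ _ _ hj]
        rfl
      simp only [Λ]
      rw [mem_ofPred_eq, this]
      exact ih
    have hsub := isPreconnected_uIcc.subset_of_closure_inter_subset (isOpen_interior (s := Λ))
      ⟨_, left_mem_uIcc, key _ left_mem_uIcc hmem⟩ fun t ht =>
        key t ht.2 (hΛ.closure_subset_iff.mpr interior_subset ht.1)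
    have hmem' : c (Sum.inr j) ∈ Λ := interior_subset (hsub right_mem_uIcc)
    exact hmem'

theorem isOpenMap_polyMap {F : ι → MvPolynomial ι k} (hF : Function.Injective (polyMap F)) :
    IsOpenMap (polyMap F) := by
  classical
  rw [isOpenMap_iff_nhds_le]
  intro x₀ N hN
  obtain ⟨ε, hε, hN⟩ := Metric.nhds_basis_closedBall.mem_iff.mp hN
  have hS : IsClosed (polyMap F '' Metric.sphere x₀ ε) :=
    ((isCompact_sphere x₀ ε).image (continuous_polyMap F)).isClosed
  have hy₀ : polyMap F x₀ ∉ polyMap F '' Metric.sphere x₀ ε := by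
    rintro ⟨x, hx, hxx⟩
    rw [hF hxx, Metric.mem_sphere, dist_self] at hx
    exact hε.ne hx
  obtain ⟨δ, hδ, hball⟩ := Metric.nhds_basis_ball.mem_iff.mp (hS.isOpen_compl.mem_nhds hy₀)
  have hδS : ∀ x ∈ Metric.sphere x₀ ε, polyMap F x ∉ Metric.ball (polyMap F x₀) δ :=
    fun x hx h => hball h ⟨x, hx, rfl⟩
  have hK : IsClosed (polyMap F '' Metric.closedBall x₀ ε) :=
    ((isCompact_closedBall x₀ ε).image (continuous_polyMap F)).isClosed
  let A := polyMap F '' Metric.closedBall x₀ ε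
  obtain ⟨x₁, hx₁g, hx₁, hx₁'⟩ := (dense_algebraicIndependent k ι).exists_mem_open
    (Metric.isOpen_ball.inter (Metric.isOpen_ball.preimage (continuous_polyMap F)))
    ⟨x₀, Metric.mem_ball_self hε, Metric.mem_ball_self hδ⟩
  have hA : A ∈ 𝓝 (polyMap F x₁) := by
    rw [← map_nhds_polyMap_of_algebraicIndependent hF hx₁g]
    exact image_mem_map (mem_of_superset (Metric.isOpen_ball.mem_nhds hx₁)
      Metric.ball_subset_closedBall)
  refine mem_of_superset (Metric.ball_mem_nhds _ hδ) fun y₂ hy₂ => ?_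
  suffices y₂ ∈ A by
    obtain ⟨x, hx, rfl⟩ := this
    exact hN hx
  rw [← show closure A = A from hK.closure_eq, mem_closure_iff]
  intro N₂ hN₂ hyN
  have hc₁ : Continuous fun c : ι ⊕ ι → ℝ => c ∘ Sum.inl := by fun_prop
  have hc₂ : Continuous fun c : ι ⊕ ι → ℝ => c ∘ Sum.inr := by fun_prop
  obtain ⟨c, hc, ⟨hcA, hcb⟩, hcN, hcb'⟩ := (dense_algebraicIndependent k (ι ⊕ ι)).exists_mem_open
    (((isOpen_interior.inter Metric.isOpen_ball).preimage hc₁).inter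
      ((hN₂.inter Metric.isOpen_ball).preimage hc₂))
    ⟨Sum.elim (polyMap F x₁) y₂, ⟨mem_interior_iff_mem_nhds.mpr hA, hx₁'⟩, hyN, hy₂⟩
  refine ⟨c ∘ Sum.inr, hcN, ?_⟩
  have := piecewise_mem_image_closedBall hF hδS hc hcb hcb' (interior_subset hcA) Finset.univ
  rwa [Finset.piecewise_univ] at this

theorem isOpenEmbedding_polyMap {F : ι → MvPolynomial ι k} (hF : Function.Injective (polyMap F)) :
    IsOpenEmbedding (polyMap F) :=
  .of_continuous_injective_isOpenMap (continuous_polyMap F) hF (isOpenMap_polyMap hF)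
end

section
variable {k : Type*} [Field k] [Algebra k ℝ] {κ : Type*} [Fintype κ]

open scoped IntermediateField.algebraAdjoinAdjoin in
/-- If `|κ|` independent numbers are algebraic over `k(w, s)`, then some `|κ| - 1` of the
coordinates of `w` are independent. -/
theorem exists_algebraicIndependent_ne [Nonempty κ] {w a : κ → ℝ} {s : ℝ}
    (ha : AlgebraicIndependent k a)
    (halg : ∀ i, IsAlgebraic (IntermediateField.adjoin k (insert s (range w))) (a i)) :
    ∃ j : κ, AlgebraicIndependent k fun i : {i // i ≠ j} => w i := by
  let M := AlgebraicIndependent.matroid k ℝ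
  have hcl : range a ⊆ M.closure (insert s (range w)) := by
    rintro _ ⟨i, rfl⟩
    rw [AlgebraicIndependent.matroid_closure_eq]
    exact (IsFractionRing.isAlgebraic_iff (Algebra.adjoin k (insert s (range w)))
      (IntermediateField.adjoin k (insert s (range w))) ℝ).mpr (halg i)
  have hind : M.Indep (range a) :=
    (algebraicIndependent_subtype_range ha.injective).mpr ha
  have h1 : (Fintype.card κ : ℕ∞) ≤ M.eRk (range w) + 1 := by
    calc (Fintype.card κ : ℕ∞) = (range a).encard := by
          rw [← image_univ, ha.injective.encard_image, encard_univ, ENat.card_eq_coe_fintype_card]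
      _ = M.eRk (range a) := hind.eRk_eq_encard.symm
      _ ≤ M.eRk (M.closure (insert s (range w))) := M.eRk_mono hcl
      _ = M.eRk (insert s (range w)) := M.eRk_closure_eq _
      _ ≤ _ := M.eRk_insert_le_add_one s _
  obtain ⟨I, hI⟩ := M.exists_isBasis (range w)
  rw [← hI.encard_eq_eRk] at h1
  obtain ⟨B, -, hB⟩ := exists_subset_bijOn (w ⁻¹' I) w
  rw [image_preimage_eq_of_subset hI.subset] at hB
  have hBind : AlgebraicIndependent k fun i : B => w i :=
    AlgebraicIndependent.comp (x := fun i : I => (i : ℝ)) hI.indep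
      (fun b : B => ⟨w b, hB.mapsTo b.2⟩)
      fun b b' h => Subtype.ext (hB.injOn b.2 b'.2 (congrArg Subtype.val h))
  have h2 : Bᶜ.encard ≤ 1 := by
    rw [← hB.image_eq, hB.injOn.encard_image] at h1
    have h3 := encard_add_encard_compl B
    rw [encard_univ, ENat.card_eq_coe_fintype_card] at h3
    rw [← h3] at h1
    exact (ENat.add_le_add_iff_left (toFinite B).encard_lt_top.ne).mp h1
  obtain ⟨j, hj⟩ : ∃ j, ∀ i, i ≠ j → i ∈ B := by
    rw [encard_le_one_iff] at h2
    by_cases hne : Bᶜ.Nonempty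
    · obtain ⟨j, hj⟩ := hne
      exact ⟨j, fun i hi => by_contra fun h => hi (h2 i j h hj)⟩
    · obtain ⟨j⟩ := ‹Nonempty κ›
      exact ⟨j, fun i _ => by_contra fun h => hne ⟨i, h⟩⟩
  exact ⟨j, hBind.comp (fun i : {i // i ≠ j} => ⟨i, hj i i.2⟩)
    fun b b' h => Subtype.ext (Subtype.mk.inj h)⟩

theorem Polynomial.dvd_of_eval₂_eq_zero {R L : Type*} [CommRing R] [IsDomain R]
    [UniqueFactorizationMonoid R] [Field L] {ρ : R →+* L} (hρ : Function.Injective ρ)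
    {H g : Polynomial R} (hH : Irreducible H) {x : L} (hHx : H.eval₂ ρ x = 0)
    (hg : g.eval₂ ρ x = 0) : H ∣ g := by
  let ρ' : FractionRing R →+* L := IsFractionRing.lift hρ
  have hval : ∀ Q : Polynomial R,
      (Q.map (algebraMap R (FractionRing R))).eval₂ ρ' x = Q.eval₂ ρ x := fun Q => by
    rw [Polynomial.eval₂_map]
    congr 1
    exact RingHom.ext fun x => IsFractionRing.lift_algebraMap hρ x
  have hdeg : H.natDegree ≠ 0 := fun h => by
    rw [Polynomial.eq_C_of_natDegree_eq_zero h, Polynomial.eval₂_C] at hHx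
    rw [Polynomial.eq_C_of_natDegree_eq_zero h, hρ (hHx.trans (map_zero ρ).symm),
      Polynomial.C_0] at hH
    exact not_irreducible_zero hH
  have hprim : H.IsPrimitive := hH.isPrimitive hdeg
  let : GCDMonoid R := UniqueFactorizationMonoid.toGCDMonoid _
  have hirr : Irreducible (H.map (algebraMap R (FractionRing R))) :=
    hprim.irreducible_iff_irreducible_map_fraction_map.mp hH
  refine hprim.dvd_of_fraction_map_dvd_fraction_map (K := FractionRing R) ?_
  by_contra h
  obtain ⟨p, q, hpq⟩ := (hirr.coprime_iff_not_dvd).mpr h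
  have h1 := congrArg (Polynomial.eval₂ ρ' x) hpq
  rw [Polynomial.eval₂_add, Polynomial.eval₂_mul, Polynomial.eval₂_mul, hval, hval, hHx, hg,
    Polynomial.eval₂_one] at h1
  simp at h1

omit [Fintype κ] in
theorem dvd_of_aeval_eq_zero_option {H g : MvPolynomial (Option κ) k} (hH : Irreducible H)
    {w : Option κ → ℝ} (hw : AlgebraicIndependent k fun i => w (some i)) (hHw : aeval w H = 0)
    (hg : aeval w g = 0) : H ∣ g := by
  let e := optionEquivLeft k κ
  let ρ : MvPolynomial κ k →+* ℝ := (aeval (R := k) fun i => w (some i)).toRingHom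
  have hval : ∀ Q : MvPolynomial (Option κ) k, (e Q).eval₂ ρ (w none) = aeval w Q := fun Q => by
    induction Q using MvPolynomial.induction_on with
    | C a => simp [e, ρ]
    | add p q hp hq => simp [hp, hq, Polynomial.eval₂_add]
    | mul_X p i hp =>
      rw [map_mul, Polynomial.eval₂_mul, hp, map_mul, aeval_X]
      congr 1
      cases i <;> simp [e, ρ]
  have hirr : Irreducible (e H) := (MulEquiv.irreducible_iff e).mpr hH
  exact (map_dvd_iff e).mp (Polynomial.dvd_of_eval₂_eq_zero (ρ := ρ) hw hirr
    ((hval H).trans hHw) ((hval g).trans hg))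

omit [Fintype κ] in
theorem dvd_of_aeval_eq_zero {H g : MvPolynomial κ k} (hH : Irreducible H)
    {w : κ → ℝ} {j : κ} (hw : AlgebraicIndependent k fun i : {i // i ≠ j} => w i)
    (hHw : aeval w H = 0) (hg : aeval w g = 0) : H ∣ g := by
  classical
  let e := Equiv.optionSubtypeNe j
  let E := renameEquiv k e.symm
  have hval : ∀ Q, aeval (w ∘ e) (E Q) = aeval w Q := fun Q => by
    simp only [E, renameEquiv_apply, aeval_rename, Function.comp_assoc, Equiv.self_comp_symm,
      Function.comp_id]
  refine (map_dvd_iff E).mp (dvd_of_aeval_eq_zero_option (w := w ∘ e)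
    ((MulEquiv.irreducible_iff E).mpr hH) ?_ ((hval H).trans hHw) ((hval g).trans hg))
  exact hw

/-- A point of transcendence degree at least `|κ| - 1` on an irreducible hypersurface is a generic
point of it. -/
theorem aeval_eq_zero_iff_dvd {H : MvPolynomial κ k} (hH : Irreducible H) {w a : κ → ℝ} {s : ℝ}
    (ha : AlgebraicIndependent k a)
    (halg : ∀ i, IsAlgebraic (IntermediateField.adjoin k (insert s (range w))) (a i))
    (hHw : aeval w H = 0) (g : MvPolynomial κ k) : aeval w g = 0 ↔ H ∣ g := by
  refine ⟨fun hg => ?_, fun ⟨q, hq⟩ => by rw [hq, map_mul, hHw, zero_mul]⟩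
  have : Nonempty κ := by
    by_contra h
    rw [not_nonempty_iff] at h
    have := eq_C_of_isEmpty H
    rw [this, aeval_C, map_eq_zero] at hHw
    rw [hHw, C_0] at this
    exact not_irreducible_zero (this ▸ hH)
  obtain ⟨j, hj⟩ := exists_algebraicIndependent_ne ha halg
  exact dvd_of_aeval_eq_zero hH hj hHw hg
end

section
variable {k : Type*} [Field k] [Countable k] [Algebra k ℝ] {κ : Type*} [Fintype κ]

omit [Countable k] [Fintype κ] in
theorem AlgebraicIndependent.aeval_ne_zero {a : κ → ℝ} (ha : AlgebraicIndependent k a)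
    {H : MvPolynomial κ k} (hH : H ≠ 0) : aeval a H ≠ 0 :=
  fun h => hH (algebraicIndependent_iff.mp ha H h)

/-- On a convex open set avoiding all generic points of an irreducible hypersurface, its equation
does not change sign. -/
theorem not_exists_sign_change_of_convex {H : MvPolynomial κ k} (hH : Irreducible H)
    {O : Set (κ → ℝ)} (hO : IsOpen O) (hOc : Convex ℝ O)
    (hgen : ∀ w ∈ O, ¬ ∀ g : MvPolynomial κ k, aeval w g = 0 ↔ H ∣ g) {c d : κ → ℝ}
    (hc : c ∈ O) (hd : d ∈ O) (hcH : aeval c H < 0) (hdH : 0 < aeval d H) : False := by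
  have hcont := H.continuous_aeval
  obtain ⟨a, ha, haO, haH⟩ := (dense_algebraicIndependent k κ).exists_mem_open
    (hO.inter (isOpen_lt hcont continuous_const)) ⟨c, hc, hcH⟩
  have hdense : DenseRange fun q : κ → ℚ => fun i => (q i : ℝ) :=
    DenseRange.piMap fun _ => Rat.denseRange_cast
  obtain ⟨q, hqO, hqH⟩ := hdense.exists_mem_open
    ((hO.inter (isOpen_lt continuous_const hcont)).preimage
      (continuous_const.add continuous_id : Continuous fun v => a + v))
    ⟨d - a, by simpa using ⟨hd, hdH⟩⟩
  set b : κ → ℝ := fun i => (q i : ℝ) with hb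
  have hpath : Continuous fun s : ℝ => aeval (a + s • b) H :=
    hcont.comp (by fun_prop)
  obtain ⟨s, hs, hsH⟩ := intermediate_value_Icc zero_le_one hpath.continuousOn
    (show (0 : ℝ) ∈ Icc _ _ from ⟨by simpa using haH.le, by simpa using hqH.le⟩)
  have hwO : a + s • b ∈ O := by
    have := hOc.add_smul_sub_mem haO hqO hs
    simpa using this
  refine hgen _ hwO (aeval_eq_zero_iff_dvd hH (s := s) ha (fun i => ?_) hsH)
  let L := IntermediateField.adjoin k (insert s (range (a + s • b)))
  have h1 : s ∈ L := IntermediateField.subset_adjoin _ _ (mem_insert _ _)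
  have h2 : (a + s • b) i ∈ L :=
    IntermediateField.subset_adjoin _ _ (mem_insert_of_mem _ (mem_range_self i))
  have h3 : a i ∈ L := by
    have : a i = (a + s • b) i - s * (q i : ℝ) := by simp [hb]
    rw [this]
    exact sub_mem h2 (mul_mem h1 (SubfieldClass.ratCast_mem L (q i)))
  exact isAlgebraic_algebraMap (⟨a i, h3⟩ : L)

/-- On a connected set avoiding a closed set that contains all generic points of an irreducible
hypersurface, its equation does not change sign. -/
theorem IsPreconnected.not_exists_sign_change {Γ : Set (κ → ℝ)} (hΓ : IsPreconnected Γ)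
    {H : MvPolynomial κ k} (hH : Irreducible H) {Z : Set (κ → ℝ)} (hZ : IsClosed Z)
    (hgen : ∀ w, (∀ g : MvPolynomial κ k, aeval w g = 0 ↔ H ∣ g) → w ∈ Z)
    (hΓZ : ∀ w ∈ Γ, w ∉ Z) {c d : κ → ℝ}
    (hc : c ∈ Γ) (hd : d ∈ Γ) (hcH : aeval c H < 0) (hdH : 0 < aeval d H) : False := by
  have hcont := H.continuous_aeval
  have hop : ∀ p : (κ → ℝ) → Prop, IsOpen {w | ∀ᶠ w' in 𝓝 w, p w'} :=
    fun p => isOpen_setOfPred_eventually_nhds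
  obtain ⟨w, -, hw₁, hw₂⟩ := hΓ {w | ∀ᶠ w' in 𝓝 w, aeval w' H ≤ 0}
    {w | ∀ᶠ w' in 𝓝 w, 0 ≤ aeval w' H} (hop _) (hop _)
    (fun w hw => by
      obtain ⟨r, hr, hball⟩ := Metric.nhds_basis_ball.mem_iff.mp
        (hZ.isOpen_compl.mem_nhds (hΓZ w hw))
      by_contra hcon
      rw [mem_union, not_or] at hcon
      have h1 : ∃ d ∈ Metric.ball w r, 0 < aeval d H := by
        by_contra! h
        exact hcon.1 (mem_of_superset (Metric.ball_mem_nhds w hr) h)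
      have h2 : ∃ c ∈ Metric.ball w r, aeval c H < 0 := by
        by_contra! h
        exact hcon.2 (mem_of_superset (Metric.ball_mem_nhds w hr) h)
      obtain ⟨d, hd, hdH⟩ := h1
      obtain ⟨c, hc, hcH⟩ := h2
      exact not_exists_sign_change_of_convex hH Metric.isOpen_ball (convex_ball w r)
        (fun v hv h => hball hv (hgen v h)) hc hd hcH hdH)
    ⟨c, hc, (hcont.continuousAt.eventually (gt_mem_nhds hcH)).mono fun _ h => h.le⟩
    ⟨d, hd, (hcont.continuousAt.eventually (lt_mem_nhds hdH)).mono fun _ h => h.le⟩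
  obtain ⟨N, hN, hNo, hwN⟩ := mem_nhds_iff.mp ((show ∀ᶠ w' in 𝓝 w, _ from hw₁).and hw₂)
  obtain ⟨a, ha, haN⟩ := (dense_algebraicIndependent k κ).exists_mem_open hNo ⟨w, hwN⟩
  exact ha.aeval_ne_zero hH.ne_zero (le_antisymm (hN haN).1 (hN haN).2)
end

section
variable {k : Type*} [Field k] {κ : Type*}

theorem MvPolynomial.totalDegree_pderiv_lt {p : MvPolynomial κ k} {i : κ} (h : pderiv i p ≠ 0) :
    (pderiv i p).totalDegree < p.totalDegree := by
  obtain ⟨m, hm, hmd⟩ := Finset.exists_mem_eq_sup _ (support_nonempty.mpr h)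
    fun m : κ →₀ ℕ => m.sum fun _ e => e
  rw [← totalDegree] at hmd
  rw [hmd]
  rw [mem_support_iff, coeff_pderiv] at hm
  have h1 := le_totalDegree (mem_support_iff.mpr (left_ne_zero_of_mul hm))
  rw [Finsupp.sum_add_index' (fun _ => rfl) (fun _ _ _ => rfl), Finsupp.sum_single_index rfl] at h1
  exact h1

theorem MvPolynomial.exists_pderiv_not_dvd [CharZero k] {H : MvPolynomial κ k}
    (hH : Irreducible H) : ∃ i, ¬ H ∣ pderiv i H := by
  classical
  by_contra! h
  have h0 : ∀ i, pderiv i H = 0 := fun i => by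
    by_contra hi
    exact (totalDegree_le_of_dvd_of_isDomain (h i) hi).not_gt (totalDegree_pderiv_lt hi)
  have hC : H = C (coeff 0 H) := by
    ext m
    rw [coeff_C]
    split_ifs with hm
    · rw [hm]
    · obtain ⟨i, hi⟩ := Finsupp.ne_iff.mp (Ne.symm hm)
      have h1 := congrArg (coeff (m - Finsupp.single i 1)) (h0 i)
      rw [coeff_pderiv, coeff_zero, tsub_add_cancel_of_le
        (Finsupp.single_le_iff.mpr (Nat.one_le_iff_ne_zero.mpr hi))] at h1
      exact (mul_eq_zero.mp h1).resolve_right (Nat.cast_add_one_ne_zero _)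
  refine hH.not_isUnit ?_
  rw [hC]
  refine (IsUnit.mk0 _ fun h => hH.ne_zero ?_).map C
  rw [hC, h, C_0]

variable [Algebra k ℝ]

theorem exists_irreducible_aeval_eq_zero {w : κ → ℝ} (hw : ¬ AlgebraicIndependent k w) :
    ∃ H : MvPolynomial κ k, Irreducible H ∧ aeval w H = 0 := by
  rw [algebraicIndependent_iff] at hw
  push Not at hw
  obtain ⟨Q, hQw, hQ⟩ := hw
  obtain ⟨f, hf, hfQ⟩ := WfDvdMonoid.exists_factors Q hQ
  have h1 : aeval w f.prod = 0 := by
    obtain ⟨q, hq⟩ := hfQ.symm.dvd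
    rw [hq, map_mul, hQw, zero_mul]
  rw [map_multiset_prod, Multiset.prod_eq_zero_iff, Multiset.mem_map] at h1
  obtain ⟨H, hH, hHw⟩ := h1
  exact ⟨H, hf H hH, hHw⟩

variable [Fintype κ]

/-- A point of transcendence degree exactly `|κ| - 1` is a generic smooth point of an irreducible
hypersurface. -/
theorem exists_generic_hypersurface [CharZero k] {w a : κ → ℝ} {s : ℝ}
    (ha : AlgebraicIndependent k a)
    (halg : ∀ i, IsAlgebraic (IntermediateField.adjoin k (insert s (range w))) (a i))
    (hw : ¬ AlgebraicIndependent k w) :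
    ∃ H : MvPolynomial κ k, Irreducible H ∧ (∀ g, aeval w g = 0 ↔ H ∣ g) ∧ H.fderivAt w ≠ 0 := by
  classical
  obtain ⟨H, hH, hHw⟩ := exists_irreducible_aeval_eq_zero hw
  have hdvd := aeval_eq_zero_iff_dvd hH ha halg hHw
  refine ⟨H, hH, hdvd, fun h => ?_⟩
  obtain ⟨i, hi⟩ := H.exists_pderiv_not_dvd hH
  rw [← hdvd] at hi
  apply hi
  have h1 := DFunLike.congr_fun h (Pi.single i 1)
  rw [fderivAt_apply] at h1
  simpa [Pi.single_apply] using h1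

theorem exists_not_ker_mem_open {H : MvPolynomial κ k} {w : κ → ℝ} (hH : H.fderivAt w ≠ 0)
    {O : Set (κ → ℝ)} (hO : IsOpen O) (hne : O.Nonempty) : ∃ b ∈ O, H.fderivAt w b ≠ 0 := by
  by_contra! h
  obtain ⟨b, hb⟩ := hne
  refine hH (ContinuousLinearMap.ext fun v => ?_)
  have h1 : ∀ᶠ t in 𝓝 (0 : ℝ), b + t • v ∈ O := by
    have : Continuous fun t : ℝ => b + t • v := by fun_prop
    exact this.continuousAt.eventually (hO.mem_nhds (by simpa using hb))
  obtain ⟨t, ht, ht0⟩ := ((h1.filter_mono nhdsWithin_le_nhds).and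
    (self_mem_nhdsWithin : {0}ᶜ ∈ 𝓝[≠] (0 : ℝ))).exists
  have h2 := h _ ht
  rw [map_add, h b hb, map_smul, zero_add, smul_eq_mul] at h2
  exact (mul_eq_zero.mp h2).resolve_left ht0
end

section
variable {ι σ : Type*} [Fintype ι] [Fintype σ]

/-- The polynomial map with monomials in `M` and coefficients `w`. -/
noncomputable def polyFamily (M : Finset (σ →₀ ℕ)) (w : ι × M → ℝ) (t : σ → ℝ) : ι → ℝ :=
  fun i => ∑ m : M, w (i, m) * ∏ j, t j ^ (m : σ →₀ ℕ) j

/-- The vector of coefficients of a tuple of polynomials. -/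
noncomputable def coeffVector (M : Finset (σ →₀ ℕ)) (p : ι → MvPolynomial σ ℝ) : ι × M → ℝ :=
  fun x => coeff (x.2 : σ →₀ ℕ) (p x.1)

/-- The universal polynomial map, as a tuple of polynomials in coefficients and variables. -/
noncomputable def universalPoly (k : Type*) [Field k] (M : Finset (σ →₀ ℕ)) (i : ι) :
    MvPolynomial ((ι × M) ⊕ σ) k :=
  ∑ m : M, X (Sum.inl (i, m)) * ∏ j, X (Sum.inr j) ^ (m : σ →₀ ℕ) j

omit [Fintype ι] in
theorem polyMap_universalPoly (k : Type*) [Field k] [Algebra k ℝ] (M : Finset (σ →₀ ℕ))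
    (w : ι × M → ℝ) (t : σ → ℝ) :
    polyMap (universalPoly k M) (Sum.elim w t) = polyFamily M w t := by
  funext i
  simp [polyMap, universalPoly, polyFamily]

omit [Fintype ι] in
theorem continuous_polyFamily (M : Finset (σ →₀ ℕ)) :
    Continuous fun x : (ι × M → ℝ) × (σ → ℝ) => polyFamily M x.1 x.2 := by
  unfold polyFamily
  fun_prop

omit [Fintype ι] in
theorem polyFamily_add (M : Finset (σ →₀ ℕ)) (w w' : ι × M → ℝ) (t : σ → ℝ) :
    polyFamily M (w + w') t = polyFamily M w t + polyFamily M w' t := by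
  funext i
  simp [polyFamily, add_mul, Finset.sum_add_distrib]

omit [Fintype ι] in
theorem polyFamily_smul (M : Finset (σ →₀ ℕ)) (s : ℝ) (w : ι × M → ℝ) (t : σ → ℝ) :
    polyFamily M (s • w) t = s • polyFamily M w t := by
  funext i
  simp [polyFamily, Finset.mul_sum, mul_assoc]

omit [Fintype ι] in
theorem polyFamily_sub (M : Finset (σ →₀ ℕ)) (w w' : ι × M → ℝ) (t : σ → ℝ) :
    polyFamily M (w - w') t = polyFamily M w t - polyFamily M w' t := by
  rw [sub_eq_add_neg, polyFamily_add, ← neg_one_smul ℝ w', polyFamily_smul, neg_one_smul,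
    ← sub_eq_add_neg]

omit [Fintype ι] in
theorem polyFamily_coeffVector {M : Finset (σ →₀ ℕ)} {p : ι → MvPolynomial σ ℝ}
    (h : ∀ i, (p i).support ⊆ M) (t : σ → ℝ) :
    polyFamily M (coeffVector M p) t = fun i => eval t (p i) := by
  funext i
  rw [eval_eq']
  refine (Finset.sum_coe_sort M fun m => coeff m (p i) * ∏ j, t j ^ m j).trans ?_
  exact (Finset.sum_subset (h i) fun m _ hm => by rw [notMem_support_iff.mp hm, zero_mul]).symm

omit [Fintype ι] in
theorem isOpen_setOf_polyFamily_mem (M : Finset (σ →₀ ℕ)) {T : Set (σ → ℝ)} (hT : IsCompact T)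
    {U : Set (ι → ℝ)} (hU : IsOpen U) : IsOpen {w | ∀ t ∈ T, polyFamily M w t ∈ U} := by
  rw [isOpen_iff_mem_nhds]
  intro w hw
  refine hT.eventually_forall_of_forall_eventually fun t ht => ?_
  exact (continuous_polyFamily M).continuousAt.eventually (hU.mem_nhds (hw t ht))

omit [Fintype ι] in
theorem isClosed_setOf_polyFamily_mem (M : Finset (σ →₀ ℕ)) {T : Set (σ → ℝ)} (hT : IsCompact T)
    {Z : Set (ι → ℝ)} (hZ : IsClosed Z) : IsClosed {w | ∃ t ∈ T, polyFamily M w t ∈ Z} := by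
  rw [← isOpen_compl_iff]
  convert isOpen_setOf_polyFamily_mem M hT hZ.isOpen_compl using 1
  ext w
  simp

omit [Fintype σ] in
/-- Polynomial maps are dense among continuous maps on a compact set. -/
theorem exists_polynomial_approx {T : Set (σ → ℝ)} (hT : IsCompact T) {φ : (σ → ℝ) → ι → ℝ}
    (hφ : ContinuousOn φ T) {ε : ℝ} (hε : 0 < ε) :
    ∃ A : ι → MvPolynomial σ ℝ, ∀ t ∈ T, dist (φ t) (fun i => eval t (A i)) < ε := by
  have : CompactSpace T := isCompact_iff_compactSpace.mp hT
  let ev : MvPolynomial σ ℝ →ₐ[ℝ] C(T, ℝ) :=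
    aeval fun j => ⟨fun t : T => (t : σ → ℝ) j,
      (continuous_apply j).comp continuous_subtype_val⟩
  have hev : ∀ p t, ev p t = eval (t : σ → ℝ) p := fun p t => by
    induction p using MvPolynomial.induction_on with
    | C a => simp [ev]
    | add p q hp hq => simp [hp, hq]
    | mul_X p i hp => rw [map_mul, ContinuousMap.mul_apply, hp]; simp [ev]
  have hsep : ev.range.SeparatesPoints := by
    intro t t' htt
    obtain ⟨j, hj⟩ := Function.ne_iff.mp (fun h => htt (Subtype.ext h))
    exact ⟨_, ⟨ev (X j), ⟨X j, rfl⟩, rfl⟩, by simpa [hev] using hj⟩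
  have key : ∀ i, ∃ p, ∀ t : T, dist (φ t i) (eval (t : σ → ℝ) p) < ε := fun i => by
    let f : C(T, ℝ) := ⟨fun t => φ t i,
      (continuous_apply i).comp (continuousOn_iff_continuous_domRestrict.mp hφ)⟩
    obtain ⟨⟨_, p, rfl⟩, hp⟩ :=
      ContinuousMap.exists_mem_subalgebra_near_continuousMap_of_separatesPoints
        ev.range hsep f ε hε
    refine ⟨p, fun t => ?_⟩
    have hd : dist (ev p) f < ε := by rw [dist_eq_norm]; exact hp
    rw [← hev, dist_comm]
    exact (ContinuousMap.dist_apply_le_dist (f := ev p) (g := f) t).trans_lt hd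
  choose A hA using key
  exact ⟨A, fun t ht => (dist_pi_lt_iff hε).mpr fun i => hA i ⟨t, ht⟩⟩
end

section
variable {ι σ : Type*} [Fintype ι] [Fintype σ]

omit [Fintype ι] in
theorem exists_preconnected_coeffs_of_segment {U : Set (ι → ℝ)} {T : Set (σ → ℝ)}
    {p q : ι → MvPolynomial σ ℝ} {M : Finset (σ →₀ ℕ)} (hp : ∀ i, (p i).support ⊆ M)
    (hq : ∀ i, (q i).support ⊆ M)
    (h : ∀ t ∈ T, segment ℝ (fun i => eval t (p i)) (fun i => eval t (q i)) ⊆ U) :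
    ∃ Γ : Set (ι × M → ℝ), IsPreconnected Γ ∧ coeffVector M p ∈ Γ ∧ coeffVector M q ∈ Γ ∧
      ∀ w ∈ Γ, ∀ t ∈ T, polyFamily M w t ∈ U := by
  refine ⟨segment ℝ (coeffVector M p) (coeffVector M q), (convex_segment _ _).isPreconnected,
    left_mem_segment _ _ _, right_mem_segment _ _ _, ?_⟩
  rintro _ ⟨a, b, ha, hb, hab, rfl⟩ t ht
  refine h t ht ⟨a, b, ha, hb, hab, ?_⟩
  rw [polyFamily_add, polyFamily_smul, polyFamily_smul, polyFamily_coeffVector hp,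
    polyFamily_coeffVector hq]

omit [Fintype ι] [Fintype σ] in
theorem polyMap_eval_eq (Φ : ι → MvPolynomial ι ℝ) (A : ι → MvPolynomial σ ℝ) (t : σ → ℝ) :
    polyMap Φ (fun i => eval t (A i)) = fun i => eval t (bind₁ A (Φ i)) := by
  funext i
  simp only [polyMap, ← aeval_eq_eval]
  exact (aeval_bind₁ _ _ _).symm

/-- Replacing the argument of a tuple of polynomials by a polynomial interpolation. -/
noncomputable def homotopyPoly (Φ : ι → MvPolynomial ι ℝ) (A B : ι → MvPolynomial σ ℝ) (i : ι) :
    Polynomial (MvPolynomial σ ℝ) :=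
  aeval (fun j => Polynomial.C (A j) + Polynomial.X * Polynomial.C (B j - A j)) (Φ i)

omit [Fintype ι] [Fintype σ] in
theorem homotopyPoly_eval (Φ : ι → MvPolynomial ι ℝ) (A B : ι → MvPolynomial σ ℝ) (i : ι)
    (s : ℝ) : (homotopyPoly Φ A B i).eval (C s) =
      bind₁ (fun j => A j + C s * (B j - A j)) (Φ i) := by
  have : ((Polynomial.aeval (R := MvPolynomial σ ℝ) (C s)).restrictScalars ℝ).comp
      (aeval fun j => Polynomial.C (A j) + Polynomial.X * Polynomial.C (B j - A j)) =
      bind₁ (fun j => A j + C s * (B j - A j)) := by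
    ext j
    simp
  have h := DFunLike.congr_fun this (Φ i)
  rw [← h, homotopyPoly]
  exact (Polynomial.coe_aeval_eq_eval (C s : MvPolynomial σ ℝ) ▸ rfl)

theorem exists_preconnected_coeffs_of_homotopy (Φ : ι → MvPolynomial ι ℝ)
    (A B : ι → MvPolynomial σ ℝ) : ∃ N : Finset (σ →₀ ℕ), ∀ M, N ⊆ M →
    ∃ Γ : Set (ι × M → ℝ), IsPreconnected Γ ∧ coeffVector M (fun i => bind₁ A (Φ i)) ∈ Γ ∧
      coeffVector M (fun i => bind₁ B (Φ i)) ∈ Γ ∧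
      ∀ w ∈ Γ, ∀ t, polyFamily M w t ∈ range (polyMap Φ) := by
  classical
  let H := homotopyPoly Φ A B
  refine ⟨Finset.univ.biUnion fun i => (H i).support.biUnion fun n => ((H i).coeff n).support,
    fun M hM => ?_⟩
  let h : ℝ → ι → MvPolynomial σ ℝ := fun s i => (H i).eval (C s)
  have hcoeff : ∀ s i m, coeff m (h s i) =
      ∑ n ∈ Finset.range ((H i).natDegree + 1), coeff m ((H i).coeff n) * s ^ n := by
    intro s i m
    simp only [h, Polynomial.eval_eq_sum_range, coeff_sum, ← C_pow]
    refine Finset.sum_congr rfl fun n _ => ?_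
    rw [mul_comm, coeff_C_mul, mul_comm]
  have hsupp : ∀ s i, (h s i).support ⊆ M := by
    intro s i m hm
    rw [mem_support_iff, hcoeff] at hm
    obtain ⟨n, -, hn⟩ := Finset.exists_ne_zero_of_sum_ne_zero hm
    have hn' := left_ne_zero_of_mul hn
    refine hM (Finset.mem_biUnion.mpr ⟨i, Finset.mem_univ _, Finset.mem_biUnion.mpr ⟨n, ?_,
      mem_support_iff.mpr hn'⟩⟩)
    rw [Polynomial.mem_support_iff]
    rintro h0
    simp [h0] at hn'
  have hcont : Continuous fun s => coeffVector M (h s) := by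
    refine continuous_pi fun x => ?_
    simp only [coeffVector, hcoeff]
    fun_prop
  have hev : ∀ s i, h s i = bind₁ (fun j => A j + C s * (B j - A j)) (Φ i) := fun s i =>
    homotopyPoly_eval Φ A B i s
  refine ⟨range fun s => coeffVector M (h s), isPreconnected_range hcont, ⟨0, ?_⟩, ⟨1, ?_⟩, ?_⟩
  · refine congrArg (coeffVector M) (funext fun i => ?_)
    simp [hev]
  · refine congrArg (coeffVector M) (funext fun i => ?_)
    simp [hev]
  · rintro _ ⟨s, rfl⟩ t
    rw [polyFamily_coeffVector (hsupp s)]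
    simp only [hev]
    exact ⟨_, polyMap_eval_eq Φ _ t⟩

omit [Fintype σ] in
theorem exists_bind₁_approx {Φ : ι → MvPolynomial ι ℝ} (hΦ : IsOpenEmbedding (polyMap Φ))
    {T : Set (σ → ℝ)} (hT : IsCompact T) {p : ι → MvPolynomial σ ℝ}
    (hp : ∀ t ∈ T, (fun i => eval t (p i)) ∈ range (polyMap Φ)) :
    ∃ A : ι → MvPolynomial σ ℝ, ∀ t ∈ T,
      segment ℝ (fun i => eval t (p i)) (fun i => eval t (bind₁ A (Φ i))) ⊆
        range (polyMap Φ) := by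
  have hpc : Continuous fun t : σ → ℝ => fun i => eval t (p i) :=
    continuous_pi fun i => (p i).continuous_eval
  choose! φ hφ using hp
  have hφc : ContinuousOn φ T := by
    rw [hΦ.isEmbedding.isInducing.continuousOn_iff]
    exact hpc.continuousOn.congr hφ
  obtain ⟨r, hr, hrU⟩ := (hT.image hpc).exists_thickening_subset_open hΦ.isOpen_range
    (by rintro _ ⟨t, ht, rfl⟩; exact ⟨_, hφ t ht⟩)
  have huc := (hT.image_of_continuousOn hφc).uniformContinuousAt_of_continuousAt (polyMap Φ)
    (fun x _ => (continuous_polyMap Φ).continuousAt) (Metric.dist_mem_uniformity hr)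
  obtain ⟨η, hη, hηr⟩ := Metric.mem_uniformity_dist.mp huc
  obtain ⟨A, hA⟩ := exists_polynomial_approx hT hφc hη
  refine ⟨A, fun t ht => ?_⟩
  have hd : dist (polyMap Φ (φ t)) (polyMap Φ fun i => eval t (A i)) < r :=
    hηr (hA t ht) (mem_image_of_mem _ ht)
  rw [hφ t ht, polyMap_eval_eq] at hd
  refine Subset.trans ?_ ((Metric.ball_subset_thickening (mem_image_of_mem _ ht) r).trans hrU)
  exact (convex_ball _ _).segment_subset (Metric.mem_ball_self hr)
    (by rwa [Metric.mem_ball, dist_comm])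

/-- Any two tuples of polynomials mapping a compact set into the image of an open polynomial
embedding can be connected through such tuples. -/
theorem exists_preconnected_coeffs {Φ : ι → MvPolynomial ι ℝ} (hΦ : IsOpenEmbedding (polyMap Φ))
    {T : Set (σ → ℝ)} (hT : IsCompact T) {p q : ι → MvPolynomial σ ℝ}
    (hp : ∀ t ∈ T, (fun i => eval t (p i)) ∈ range (polyMap Φ))
    (hq : ∀ t ∈ T, (fun i => eval t (q i)) ∈ range (polyMap Φ)) :
    ∃ N : Finset (σ →₀ ℕ), ∀ M, N ⊆ M →
    ∃ Γ : Set (ι × M → ℝ), IsPreconnected Γ ∧ coeffVector M p ∈ Γ ∧ coeffVector M q ∈ Γ ∧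
      ∀ w ∈ Γ, ∀ t ∈ T, polyFamily M w t ∈ range (polyMap Φ) := by
  classical
  obtain ⟨A, hA⟩ := exists_bind₁_approx hΦ hT hp
  obtain ⟨B, hB⟩ := exists_bind₁_approx hΦ hT hq
  obtain ⟨N, hN⟩ := exists_preconnected_coeffs_of_homotopy Φ A B
  let supp : (ι → MvPolynomial σ ℝ) → Finset (σ →₀ ℕ) := fun f =>
    Finset.univ.biUnion fun i => (f i).support
  have hsupp : ∀ f i, (f i).support ⊆ supp f := fun f i =>
    Finset.subset_biUnion_of_mem (fun i => (f i).support) (Finset.mem_univ i)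
  refine ⟨N ∪ (supp p ∪ supp q ∪ (supp (fun i => bind₁ A (Φ i)) ∪
    supp fun i => bind₁ B (Φ i))), fun M hM => ?_⟩
  simp only [Finset.union_subset_iff] at hM
  obtain ⟨hNM, ⟨hpM, hqM⟩, hAM, hBM⟩ := hM
  obtain ⟨Γ₁, h₁, hp₁, hA₁, hU₁⟩ := exists_preconnected_coeffs_of_segment
    (fun i => (hsupp p i).trans hpM) (fun i => (hsupp (fun i => bind₁ A (Φ i)) i).trans hAM) hA
  obtain ⟨Γ₂, h₂, hq₂, hB₂, hU₂⟩ := exists_preconnected_coeffs_of_segment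
    (fun i => (hsupp q i).trans hqM) (fun i => (hsupp (fun i => bind₁ B (Φ i)) i).trans hBM) hB
  obtain ⟨Γ, h, hAΓ, hBΓ, hU⟩ := hN M hNM
  refine ⟨Γ₁ ∪ Γ ∪ Γ₂, (h₁.union _ hA₁ hAΓ h).union _ (Or.inr hBΓ) hB₂ h₂,
    Or.inl (Or.inl hp₁), Or.inr hq₂, ?_⟩
  rintro w ((hw | hw) | hw) t ht
  exacts [hU₁ w hw t ht, hU w hw t, hU₂ w hw t ht]
end

theorem HasFDerivAt.exists_norm_sub_le {E F : Type*} [NormedAddCommGroup E] [NormedSpace ℝ E]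
    [FiniteDimensional ℝ E] [NormedAddCommGroup F] [NormedSpace ℝ F] {G : E → F} {G' : E →L[ℝ] F}
    {z : E} (hG : HasFDerivAt G G' z) (hinj : Function.Injective G') :
    ∃ C > 0, ∀ᶠ y in 𝓝 z, ‖y - z‖ ≤ C * ‖G y - G z‖ := by
  obtain ⟨K, hK, hanti⟩ := LinearMap.exists_antilipschitzWith (G' : E →ₗ[ℝ] F)
    (LinearMap.ker_eq_bot.mpr hinj)
  have hK' : (0 : ℝ) < K := hK
  refine ⟨2 * K, by positivity, ?_⟩
  filter_upwards [hG.isLittleO.def (show (0 : ℝ) < 1 / (2 * K) by positivity)] with y hy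
  have h1 : ‖y - z‖ ≤ K * ‖G' (y - z)‖ := by
    simpa using hanti.le_mul_dist (y - z) 0
  have h2 : ‖G' (y - z)‖ ≤ ‖G y - G z‖ + 1 / (2 * K) * ‖y - z‖ := by
    have := norm_sub_le (G y - G z) (G y - G z - G' (y - z))
    rw [sub_sub_cancel] at this
    linarith
  have h3 : K * ‖G' (y - z)‖ ≤ K * ‖G y - G z‖ + 1 / 2 * ‖y - z‖ := by
    refine (mul_le_mul_of_nonneg_left h2 hK'.le).trans_eq ?_
    field_simp
  linarith

section
variable {k : Type*} [Field k] [CharZero k] [Algebra k ℝ]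

theorem exists_relation_pderiv_none_ne_zero {κ : Type*} [Fintype κ] {w : Option κ → ℝ}
    (hind : AlgebraicIndependent k fun i => w (some i)) (hw : ¬ AlgebraicIndependent k w) :
    ∃ H : MvPolynomial (Option κ) k, aeval w H = 0 ∧ aeval w (pderiv none H) ≠ 0 := by
  obtain ⟨H, hH, hHw⟩ := exists_irreducible_aeval_eq_zero hw
  refine ⟨H, hHw, fun h0 => ?_⟩
  obtain ⟨i, hi⟩ := H.exists_pderiv_not_dvd hH
  refine hi (dvd_of_aeval_eq_zero_option hH hind hHw ?_)
  cases i with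
  | none => exact h0
  | some i =>
    classical
    obtain ⟨D, hD⟩ := exists_derivation_of_algebraicIndependent hind (Pi.single i 1)
    have h := D.map_aeval_mvPolynomial w H
    rw [hHw, map_zero, Fintype.sum_option, h0, zero_mul, zero_add] at h
    simpa [hD, Pi.single_apply] using h.symm

omit [CharZero k] in
theorem MvPolynomial.fderivAt_rename {κ ι : Type*} [Fintype κ] [Fintype ι] (f : κ → ι)
    (H : MvPolynomial κ k) (x v : ι → ℝ) :
    (rename f H).fderivAt x v = H.fderivAt (x ∘ f) (v ∘ f) := by
  let L : (ι → ℝ) →L[ℝ] (κ → ℝ) := ContinuousLinearMap.pi fun j => ContinuousLinearMap.proj (f j)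
  have h1 : HasFDerivAt (fun y : ι → ℝ => aeval (L y) H) ((H.fderivAt (x ∘ f)).comp L) x :=
    HasFDerivAt.comp x (H.hasStrictFDerivAt_aeval (L x)).hasFDerivAt L.hasFDerivAt
  have h2 := ((rename f H).hasStrictFDerivAt_aeval x).hasFDerivAt
  have h3 : (fun y : ι → ℝ => aeval y (rename f H)) = fun y => aeval (L y) H := by
    funext y
    rw [aeval_rename]
    rfl
  rw [h3] at h2
  rw [h2.unique h1]
  rfl

/-- If `z` is algebraic over its coordinates in `S`, it is an isolated point, in a Lipschitz sense,
of the fibres over `S` of a variety defined by equations over `k`. -/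
theorem exists_relations_lipschitz {ι : Type*} [Fintype ι] {z : ι → ℝ} {S : Set ι}
    (hS : AlgebraicIndependent k fun i : S => z i)
    (hmax : ∀ j ∉ S, ¬ AlgebraicIndependent k fun o : Option S => o.elim (z j) fun i => z i) :
    ∃ R : ι → MvPolynomial ι k, (∀ j ∉ S, aeval z (R j) = 0) ∧ ∃ C > 0, ∀ᶠ y in 𝓝 z,
      (∀ j ∉ S, aeval y (R j) = 0) → ∀ c ≥ 0, (∀ i ∈ S, |y i - z i| ≤ c) → ‖y - z‖ ≤ C * c := by
  classical
  have key : ∀ j, ∃ R : MvPolynomial ι k, j ∉ S → aeval z R = 0 ∧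
      ∀ v : ι → ℝ, (∀ i ∈ S, v i = 0) → R.fderivAt z v = 0 → v j = 0 := by
    intro j
    by_cases hj : j ∈ S
    · exact ⟨0, fun h => absurd hj h⟩
    obtain ⟨H, hH, hH'⟩ := exists_relation_pderiv_none_ne_zero (w := fun o : Option S =>
      o.elim (z j) fun i => z i) hS (hmax j hj)
    let f : Option S → ι := fun o => o.elim j fun i => i
    have hf : z ∘ f = fun o : Option S => o.elim (z j) fun i => z i := by
      funext o
      cases o <;> rfl
    refine ⟨rename f H, fun _ => ⟨by rw [aeval_rename, hf, hH], fun v hv hv0 => ?_⟩⟩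
    rw [fderivAt_rename, fderivAt_apply, Fintype.sum_option, hf, Finset.sum_eq_zero, add_zero]
      at hv0
    · exact (mul_eq_zero.mp hv0).resolve_left hH'
    · intro i _
      exact mul_eq_zero_of_right _ (hv _ i.2)
  choose R hR using key
  refine ⟨R, fun j hj => (hR j hj).1, ?_⟩
  let G : ι → MvPolynomial ι k := fun i => if i ∈ S then X i else R i
  have hinj : Function.Injective (polyMapDeriv G z) := by
    rw [injective_iff_map_eq_zero]
    intro v hv
    have hvS : ∀ i ∈ S, v i = 0 := fun i hi => by
      have h := congrFun hv i
      simp only [polyMapDeriv, ContinuousLinearMap.pi_apply, G, if_pos hi, fderivAt_apply] at h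
      simpa [pderiv_X, Pi.single_apply, apply_ite (aeval z)] using h
    funext j
    by_cases hj : j ∈ S
    · exact hvS j hj
    · refine (hR j hj).2 v hvS ?_
      have h := congrFun hv j
      simpa only [polyMapDeriv, ContinuousLinearMap.pi_apply, G, if_neg hj, Pi.zero_apply] using h
  obtain ⟨C, hC, hCy⟩ := (hasStrictFDerivAt_polyMap G z).hasFDerivAt.exists_norm_sub_le hinj
  refine ⟨C, hC, ?_⟩
  filter_upwards [hCy] with y hy hyR c hc hyS
  refine hy.trans (mul_le_mul_of_nonneg_left ?_ hC.le)
  refine (pi_norm_le_iff_of_nonneg hc).mpr fun i => ?_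
  by_cases hi : i ∈ S
  · simpa [polyMap, G, hi] using hyS i hi
  · simp [polyMap, G, hi, hyR i hi, (hR i hi).1, hc]
end

section
variable {k : Type*} [Field k] [Algebra k ℝ]

open scoped IntermediateField.algebraAdjoinAdjoin in
theorem isAlgebraic_adjoin_of_not_algebraicIndependent_option {κ : Type*} {x : κ → ℝ} {a : ℝ}
    (hx : AlgebraicIndependent k x)
    (h : ¬ AlgebraicIndependent k fun o : Option κ => o.elim a x) :
    IsAlgebraic (IntermediateField.adjoin k (range x)) a := by
  rw [hx.option_iff_transcendental, Transcendental, not_not] at h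
  exact (IsFractionRing.isAlgebraic_iff (Algebra.adjoin k (range x))
    (IntermediateField.adjoin k (range x)) ℝ).mp h

theorem countable_setOf_algebraic_fibre [Countable k] {ι : Type*} [Finite ι] {S : Set ι}
    {z : ι → ℝ} (hS : AlgebraicIndependent k fun i : S => z i) {E : Set (ι → ℝ)}
    (hE : ∀ y ∈ E, (∀ i ∈ S, y i = z i) ∧
      ∀ j ∉ S, ¬ AlgebraicIndependent k fun o : Option S => o.elim (y j) fun i => z i) :
    E.Countable := by
  let K := IntermediateField.adjoin k (range fun i : S => z i)
  have : Countable K := countable_adjoin_range fun i : S => z i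
  have hc : (pi univ fun _ : ι => {a : ℝ | IsAlgebraic K a}).Countable :=
    Set.countable_univ_pi fun _ => Algebraic.countable K ℝ
  refine hc.mono ?_
  intro y hy i _
  by_cases hi : i ∈ S
  · rw [(hE y hy).1 i hi]
    exact isAlgebraic_algebraMap
      (⟨z i, IntermediateField.subset_adjoin _ _ ⟨⟨i, hi⟩, rfl⟩⟩ : K)
  · exact isAlgebraic_adjoin_of_not_algebraicIndependent_option hS ((hE y hy).2 i hi)

theorem algebraicIndependent_insert {ι : Type*} {S : Set ι} {y : ι → ℝ} {j : ι} (hj : j ∉ S)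
    (h : AlgebraicIndependent k fun o : Option S => o.elim (y j) fun i => y i) :
    AlgebraicIndependent k fun i : ↥(insert j S) => y i := by
  obtain ⟨h1, h2⟩ := AlgebraicIndependent.option_iff.mp h
  refine (AlgebraicIndepOn.insert_iff hj).mpr ⟨h1, ?_⟩
  rwa [image_eq_range]

/-- A point missed by an injective polynomial map can be chosen with a maximal algebraically
independent set of coordinates, among all points missed. -/
theorem exists_maximal_notMem_range [Countable k] [CharZero k] {ι : Type*} [Fintype ι]
    {F : ι → MvPolynomial ι k} (hF : Function.Injective (polyMap F))
    (hZ : ((range (polyMap F))ᶜ).Nonempty) :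
    ∃ z ∉ range (polyMap F), ∃ S : Set ι, (AlgebraicIndependent k fun i : S => z i) ∧ S ≠ univ ∧
      ∀ y ∉ range (polyMap F), (∀ i ∈ S, y i = z i) → ∀ j ∉ S,
        ¬ AlgebraicIndependent k fun o : Option S => o.elim (y j) fun i => z i := by
  classical
  let A : Set (Set ι) := {S | ∃ z ∉ range (polyMap F), AlgebraicIndependent k fun i : S => z i}
  have hA : A.Nonempty := by
    obtain ⟨z, hz⟩ := hZ
    refine ⟨∅, z, hz, ?_⟩
    rw [algebraicIndependent_empty_type_iff]
    exact (algebraMap k ℝ).injective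
  obtain ⟨S, hSmax⟩ := (toFinite A).exists_maximal hA
  obtain ⟨z, hz, hS⟩ := hSmax.prop
  refine ⟨z, hz, S, hS, ?_, ?_⟩
  · rintro rfl
    have hz' : AlgebraicIndependent k z :=
      hS.comp (fun i => ⟨i, mem_univ i⟩) fun i j h => congrArg Subtype.val h
    obtain ⟨u, hu, hu'⟩ := (dense_algebraicIndependent k ι).exists_mem_open
      (isOpenEmbedding_polyMap hF).isOpen_range (range_nonempty _)
    exact hz ((SameType.of_algebraicIndependent hu hz').mem_range_polyMap hF hu')
  · intro y hy hyS j hj h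
    have hyS' : (fun i : S => z i) = fun i : S => y i := funext fun i => (hyS i i.2).symm
    rw [hyS'] at h
    exact hj (hSmax.le_of_ge ⟨y, hy, algebraicIndependent_insert hj h⟩ (subset_insert j S)
      (mem_insert j S))
end

theorem countable_setOf_sum_sq_eq {σ : Type*} [Fintype σ] {t₀ : σ → ℝ} (ht₀ : ∑ j, t₀ j ^ 2 = 1)
    (v : σ → ℝ) (r : ℝ) : {x : ℝ | ∑ j, (v j - x * t₀ j) ^ 2 = r}.Countable := by
  let p : Polynomial ℝ := Polynomial.X ^ 2 - Polynomial.C (2 * ∑ j, v j * t₀ j) * Polynomial.X +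
    Polynomial.C (∑ j, v j ^ 2 - r)
  have hp : p ≠ 0 := by
    intro h
    have := congrArg (Polynomial.coeff · 2) h
    rw [Polynomial.coeff_add, Polynomial.coeff_sub, Polynomial.coeff_C_mul,
      Polynomial.coeff_X_pow, Polynomial.coeff_X, Polynomial.coeff_C] at this
    norm_num at this
  refine ((p.rootSet_finite ℝ).subset ?_).countable
  intro x hx
  rw [mem_ofPred_eq] at hx
  rw [Polynomial.mem_rootSet]
  refine ⟨hp, ?_⟩
  have h1 : ∑ j, (v j - x * t₀ j) ^ 2 =
      ∑ j, v j ^ 2 - 2 * x * ∑ j, v j * t₀ j + x ^ 2 * ∑ j, t₀ j ^ 2 := by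
    simp only [Finset.mul_sum, ← Finset.sum_sub_distrib, ← Finset.sum_add_distrib]
    exact Finset.sum_congr rfl fun j _ => by ring
  rw [ht₀] at h1
  simp only [p, Polynomial.coe_aeval_eq_eval, Polynomial.eval_add, Polynomial.eval_sub,
    Polynomial.eval_mul, Polynomial.eval_pow, Polynomial.eval_X, Polynomial.eval_C]
  linarith

/-- A sphere through the origin can be moved slightly inwards and outwards along a radius so as to
avoid a given countable set. -/
theorem exists_offset_avoiding {σ : Type*} [Fintype σ] {t₀ : σ → ℝ} (ht₀ : ∑ j, t₀ j ^ 2 = 1)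
    {E : Set (σ → ℝ)} (hE : E.Countable) {ρ : ℝ} (hρ : 0 < ρ) : ∃ δ, 0 < δ ∧ δ < ρ / 2 ∧
      ∀ t : σ → ℝ, ∑ j, t j ^ 2 = 1 →
        ρ • (t - t₀) + δ • t₀ ∉ E ∧ ρ • (t - t₀) - δ • t₀ ∉ E := by
  have hB : (⋃ v ∈ E, {x : ℝ | ∑ j, ((v + ρ • t₀) j - x * t₀ j) ^ 2 = ρ ^ 2} ∪
      {x : ℝ | ∑ j, (-(v + ρ • t₀) j - x * t₀ j) ^ 2 = ρ ^ 2}).Countable :=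
    hE.biUnion fun v _ => (countable_setOf_sum_sq_eq ht₀ (v + ρ • t₀) _).union
      (countable_setOf_sum_sq_eq ht₀ (-(v + ρ • t₀)) _)
  obtain ⟨δ, hδ, hδρ⟩ := (hB.dense_compl ℝ).exists_mem_open isOpen_Ioo
    (nonempty_Ioo.mpr (half_pos hρ))
  simp only [mem_compl_iff, mem_iUnion, not_exists, mem_union, not_or, mem_ofPred_eq] at hδ
  refine ⟨δ, hδρ.1, hδρ.2, fun t ht => ⟨fun hv => (hδ _ hv).1 ?_, fun hv => (hδ _ hv).2 ?_⟩⟩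
  · rw [← mul_one (ρ ^ 2), ← ht, Finset.mul_sum]
    refine Finset.sum_congr rfl fun j _ => ?_
    simp only [Pi.add_apply, Pi.smul_apply, Pi.sub_apply, smul_eq_mul]
    ring
  · rw [← mul_one (ρ ^ 2), ← ht, Finset.mul_sum]
    refine Finset.sum_congr rfl fun j _ => ?_
    simp only [Pi.add_apply, Pi.smul_apply, Pi.sub_apply, smul_eq_mul]
    ring

/-- Near any point whose coordinates in `P` are independent there is a generic point with the same
coordinates in `P`. -/
theorem exists_generic_extension {k : Type*} [Field k] [Countable k] [Algebra k ℝ] {κ : Type*}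
    [Finite κ] {P : Set κ} {v : κ → ℝ} (hv : AlgebraicIndependent k fun i : P => v i)
    {N : Set (κ → ℝ)} (hN : N ∈ 𝓝 v) :
    ∃ a ∈ N, (∀ i ∈ P, a i = v i) ∧ AlgebraicIndependent k a := by
  classical
  let K := IntermediateField.adjoin k (range fun i : P => v i)
  have : Countable K := countable_adjoin_range fun i : P => v i
  let g : ({i // i ∉ P} → ℝ) → κ → ℝ := fun b i => if h : i ∈ P then v i else b ⟨i, h⟩
  have hg : Continuous g := by
    refine continuous_pi fun i => ?_
    by_cases h : i ∈ P
    · simp only [g, h, dite_true]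
      exact continuous_const
    · simp only [g, h, dite_false]
      exact continuous_apply _
  have hgv : g (fun i => v i) = v := by
    funext i
    simp [g]
  have hN' : g ⁻¹' N ∈ 𝓝 fun i : {i // i ∉ P} => v i :=
    hg.continuousAt.preimage_mem_nhds (by rwa [hgv])
  obtain ⟨b, hb, hbN⟩ := (dense_algebraicIndependent K {i // i ∉ P}).inter_nhds_nonempty hN'
  refine ⟨g b, hbN, fun i hi => by simp [g, hi], ?_⟩
  have hle : Algebra.adjoin k (range fun i : P => v i) ≤ K.toSubalgebra :=
    IntermediateField.algebra_adjoin_le_adjoin k _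
  let _ : Algebra (Algebra.adjoin k (range fun i : P => v i)) K :=
    (Subalgebra.inclusion hle).toAlgebra
  have : IsScalarTower (Algebra.adjoin k (range fun i : P => v i)) K ℝ :=
    IsScalarTower.of_algebraMap_eq fun _ => rfl
  have hb' : AlgebraicIndependent (Algebra.adjoin k (range fun i : P => v i)) b :=
    AlgebraicIndependent.restrictScalars (K := K) (Subalgebra.inclusion_injective hle) hb
  have hsum := AlgebraicIndependent.sumElim_iff.mpr ⟨hv, hb'⟩
  let e : κ → {i // i ∉ P} ⊕ P := fun i => if h : i ∈ P then Sum.inr ⟨i, h⟩ else Sum.inl ⟨i, h⟩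
  have he : Function.Injective e := by
    intro i j hij
    by_cases hi : i ∈ P <;> by_cases hj : j ∈ P <;> simp [e, hi, hj] at hij <;> exact hij
  convert hsum.comp e he using 1
  funext i
  by_cases hi : i ∈ P <;> simp [g, e, hi]

section
variable {ι σ : Type*} [Fintype ι] [Fintype σ]

theorem exists_polyFamily_lipschitz (M : Finset (σ →₀ ℕ)) : ∃ L > 0, ∀ (u : ι × M → ℝ)
    (t t' : σ → ℝ), ‖t‖ ≤ 1 → ‖t'‖ ≤ 1 →
      ‖polyFamily M u t - polyFamily M u t'‖ ≤ L * ‖u‖ * ‖t - t'‖ ∧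
      ‖polyFamily M u t‖ ≤ L * ‖u‖ := by
  have key : ∀ m : M, ∃ K : NNReal, LipschitzOnWith K
      (fun t : σ → ℝ => ∏ j, t j ^ (m : σ →₀ ℕ) j) (Metric.closedBall 0 1) := fun m => by
    refine LocallyLipschitzOn.exists_lipschitzOnWith_of_compact (isCompact_closedBall _ _)
      (LocallyLipschitz.locallyLipschitzOn (ContDiff.locallyLipschitz (𝕂 := ℝ) ?_))
    fun_prop
  choose K hK using key
  refine ⟨∑ m, (K m : ℝ) + Fintype.card M + 1, by positivity, fun u t t' ht ht' => ?_⟩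
  have hu : ∀ i m, |u (i, m)| ≤ ‖u‖ := fun i m => norm_le_pi_norm u (i, m)
  constructor
  · have h1 : ‖polyFamily M u t - polyFamily M u t'‖ ≤ (∑ m, (K m : ℝ)) * ‖u‖ * ‖t - t'‖ := by
      refine (pi_norm_le_iff_of_nonneg (by positivity)).mpr fun i => ?_
      simp only [polyFamily, Pi.sub_apply, ← Finset.sum_sub_distrib, Finset.sum_mul, ← mul_sub]
      refine (norm_sum_le _ _).trans (Finset.sum_le_sum fun m _ => ?_)
      have h2 := (hK m).dist_le_mul t (by simpa using ht) t' (by simpa using ht')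
      rw [dist_eq_norm, dist_eq_norm] at h2
      rw [norm_mul, mul_comm (K m : ℝ), mul_assoc]
      exact mul_le_mul (hu i m) h2 (norm_nonneg _) (norm_nonneg _)
    refine h1.trans ?_
    gcongr
    linarith [(Nat.cast_nonneg (Fintype.card M) : (0 : ℝ) ≤ _)]
  · have h1 : ‖polyFamily M u t‖ ≤ Fintype.card M * ‖u‖ := by
      refine (pi_norm_le_iff_of_nonneg (by positivity)).mpr fun i => ?_
      rw [← nsmul_eq_mul, Fintype.card, ← Finset.sum_const]
      refine (norm_sum_le _ _).trans (Finset.sum_le_sum fun m _ => ?_)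
      rw [norm_mul, norm_prod]
      refine (mul_le_of_le_one_right (norm_nonneg _) (Finset.prod_le_one
        (fun _ _ => norm_nonneg _) fun j _ => ?_)).trans (hu i m)
      rw [norm_pow]
      exact pow_le_one₀ (norm_nonneg _) ((norm_le_pi_norm t j).trans ht)
    refine h1.trans ?_
    gcongr
    have : (0 : ℝ) ≤ ∑ m, (K m : ℝ) := by positivity
    linarith

omit [Fintype ι] in
theorem norm_le_one_of_sum_sq {t : σ → ℝ} (ht : ∑ j, t j ^ 2 = 1) : ‖t‖ ≤ 1 := by
  refine (pi_norm_le_iff_of_nonneg zero_le_one).mpr fun j => ?_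
  rw [Real.norm_eq_abs, ← sq_le_one_iff_abs_le_one, ← ht]
  exact Finset.single_le_sum (f := fun j => t j ^ 2) (fun _ _ => sq_nonneg _) (Finset.mem_univ j)

omit [Fintype ι] in
theorem norm_sq_le_sum_sq (t : σ → ℝ) : ‖t‖ ^ 2 ≤ ∑ j, t j ^ 2 := by
  refine (Real.le_sqrt (norm_nonneg _) (by positivity)).mp ?_
  refine (pi_norm_le_iff_of_nonneg (Real.sqrt_nonneg _)).mpr fun j => ?_
  rw [Real.norm_eq_abs]
  refine Real.abs_le_sqrt ?_
  exact Finset.single_le_sum (f := fun j => t j ^ 2) (fun _ _ => sq_nonneg _) (Finset.mem_univ j)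

omit [Fintype ι] in
theorem sum_sq_le_card_mul (t : σ → ℝ) : ∑ j, t j ^ 2 ≤ Fintype.card σ * ‖t‖ ^ 2 := by
  rw [← nsmul_eq_mul, Fintype.card, ← Finset.sum_const]
  refine Finset.sum_le_sum fun j _ => ?_
  rw [← sq_abs]
  exact pow_le_pow_left₀ (abs_nonneg _) (norm_le_pi_norm t j) 2

omit [Fintype ι] in
/-- Polar coordinates around a point of a sphere are bi-Lipschitz. -/
theorem sphere_polar_lower_bound {t t₀ : σ → ℝ} (ht : ∑ j, t j ^ 2 = 1) (ht₀ : ∑ j, t₀ j ^ 2 = 1)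
    {ρ s : ℝ} (hρ : 0 < ρ) (hρ1 : ρ ≤ 1) (hs : |s| ≤ ρ / 2) :
    (ρ / 2 * (‖t - t₀‖ + |s|)) ^ 2 ≤ Fintype.card σ * ‖ρ • (t - t₀) + s • t₀‖ ^ 2 := by
  refine le_trans ?_ (sum_sq_le_card_mul _)
  have h1 : ∑ j, (ρ • (t - t₀) + s • t₀) j ^ 2 =
      ρ * (ρ - s) * ∑ j, (t - t₀) j ^ 2 + s ^ 2 := by
    have h2 : ∑ j, (ρ • (t - t₀) + s • t₀) j ^ 2 = ρ * (ρ - s) * ∑ j, (t - t₀) j ^ 2 +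
        ρ * s * ∑ j, t j ^ 2 + (s ^ 2 - ρ * s) * ∑ j, t₀ j ^ 2 := by
      simp only [Finset.mul_sum, ← Finset.sum_add_distrib]
      refine Finset.sum_congr rfl fun j _ => ?_
      simp only [Pi.add_apply, Pi.smul_apply, Pi.sub_apply, smul_eq_mul]
      ring
    rw [h2, ht, ht₀]
    ring
  rw [h1]
  have h3 := norm_sq_le_sum_sq (t - t₀)
  have h4 : ρ ^ 2 / 2 ≤ ρ * (ρ - s) := by nlinarith [(abs_le.mp hs).2]
  have h5 : ρ ^ 2 / 2 * ‖t - t₀‖ ^ 2 ≤ ρ * (ρ - s) * ∑ j, (t - t₀) j ^ 2 :=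
    mul_le_mul h4 h3 (sq_nonneg _) (le_trans (by positivity) h4)
  have h6 : ρ ^ 2 / 2 * |s| ^ 2 ≤ s ^ 2 := by
    rw [sq_abs]
    nlinarith [sq_nonneg s, mul_le_mul hρ1 hρ1 hρ.le zero_le_one]
  nlinarith [sq_nonneg (‖t - t₀‖ - |s|), sq_nonneg ρ, mul_nonneg (sq_nonneg ρ) (sq_nonneg (‖t - t₀‖ - |s|))]
end

section
variable {ι : Type*} [Fintype ι] {S : Set ι}

open Classical in
/-- Extension by zero of a vector with coordinates outside `S`. -/
noncomputable def extendZero (S : Set ι) : ({j // j ∉ S} → ℝ) →ₗ[ℝ] (ι → ℝ) where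
  toFun v i := if h : i ∉ S then v ⟨i, h⟩ else 0
  map_add' v w := by ext i; by_cases h : i ∈ S <;> simp [h]
  map_smul' c v := by ext i; by_cases h : i ∈ S <;> simp [h]

omit [Fintype ι] in
theorem extendZero_of_mem (v : {j // j ∉ S} → ℝ) {i : ι} (h : i ∈ S) : extendZero S v i = 0 := by
  simp [extendZero, h]

omit [Fintype ι] in
theorem extendZero_of_notMem (v : {j // j ∉ S} → ℝ) (j : {j // j ∉ S}) :
    extendZero S v j = v j := by
  simp [extendZero, j.2]

variable [Fintype {j // j ∉ S}]

theorem norm_extendZero_le (v : {j // j ∉ S} → ℝ) : ‖extendZero S v‖ ≤ ‖v‖ := by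
  refine (pi_norm_le_iff_of_nonneg (norm_nonneg _)).mpr fun i => ?_
  by_cases h : i ∈ S
  · simp [extendZero_of_mem v h]
  · rw [extendZero_of_notMem v ⟨i, h⟩]
    exact norm_le_pi_norm v _

theorem norm_le_norm_extendZero (v : {j // j ∉ S} → ℝ) : ‖v‖ ≤ ‖extendZero S v‖ := by
  refine (pi_norm_le_iff_of_nonneg (norm_nonneg _)).mpr fun j => ?_
  rw [← extendZero_of_notMem v j]
  exact norm_le_pi_norm _ _

/-- A set with isolated Lipschitz fibre at `z` meets a small perturbation of a family of nearby
spheres through `z` at most in `z`. -/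
theorem eq_of_mem_perturbed_sphere {z : ι → ℝ} {V : Set (ι → ℝ)} {C r ρ η : ℝ}
    (hV : ∀ y ∈ V, ‖y - z‖ < r → ∀ c ≥ 0, (∀ i ∈ S, |y i - z i| ≤ c) → ‖y - z‖ ≤ C * c)
    (hρ : 0 < ρ) (hρ1 : ρ ≤ 1) (hρr : 4 * ρ ≤ r) (hη : 0 < η) (hηρ : 6 * η ≤ ρ)
    (hηC : Fintype.card {j // j ∉ S} * ((C + 1) * η) ^ 2 < (ρ / 2) ^ 2)
    {t t₀ : {j // j ∉ S} → ℝ} (ht : ∑ j, t j ^ 2 = 1) (ht₀ : ∑ j, t₀ j ^ 2 = 1) {s : ℝ}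
    (hs : |s| ≤ ρ / 2) {e : ι → ℝ} (he : ‖e‖ ≤ η * (‖t - t₀‖ + |s|))
    (hy : z + extendZero S (ρ • (t - t₀) + s • t₀) + e ∈ V) : t = t₀ ∧ s = 0 := by
  set X := ‖t - t₀‖ + |s| with hX
  set u := ρ • (t - t₀) + s • t₀ with hu
  have hX0 : 0 ≤ X := by positivity
  have hx2 : ‖t - t₀‖ ≤ 2 := by
    linarith [norm_sub_le t t₀, norm_le_one_of_sum_sq ht, norm_le_one_of_sum_sq ht₀]
  have hunorm : ‖u‖ ≤ ρ * ‖t - t₀‖ + |s| := by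
    refine (norm_add_le _ _).trans ?_
    rw [norm_smul, norm_smul, Real.norm_eq_abs, Real.norm_eq_abs, abs_of_pos hρ]
    gcongr
    exact mul_le_of_le_one_right (abs_nonneg _) (norm_le_one_of_sum_sq ht₀)
  have hyz : z + extendZero S u + e - z = extendZero S u + e := by abel
  have hlt : ‖extendZero S u + e‖ < r := by
    have h1 : η * X ≤ η * 3 := by
      gcongr
      linarith
    have h2 : ρ * ‖t - t₀‖ ≤ ρ * 2 := by gcongr
    have := norm_add_le (extendZero S u) e
    linarith [norm_extendZero_le (S := S) u]
  have hle : ‖extendZero S u + e‖ ≤ C * (η * X) := by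
    have h := hV _ hy
    rw [hyz] at h
    refine h hlt _ (by positivity) fun i hi => ?_
    rw [← Pi.sub_apply, hyz, Pi.add_apply, extendZero_of_mem u hi, zero_add]
    exact (norm_le_pi_norm e i).trans he
  have hule : ‖u‖ ≤ (C + 1) * η * X := by
    have h1 := norm_sub_le (extendZero S u + e) e
    rw [add_sub_cancel_right] at h1
    linarith [norm_le_norm_extendZero (S := S) u]
  have hlow := sphere_polar_lower_bound ht ht₀ hρ hρ1 hs
  rw [← hu, ← hX] at hlow
  have hX00 : X = 0 := by
    by_contra hne
    have hXpos : 0 < X := lt_of_le_of_ne hX0 (Ne.symm hne)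
    have h1 : ‖u‖ ^ 2 ≤ ((C + 1) * η * X) ^ 2 := pow_le_pow_left₀ (norm_nonneg _) hule 2
    have h2 : (Fintype.card {j // j ∉ S} : ℝ) * ‖u‖ ^ 2 ≤
        Fintype.card {j // j ∉ S} * ((C + 1) * η * X) ^ 2 := by gcongr
    have h3 : (Fintype.card {j // j ∉ S} : ℝ) * ((C + 1) * η * X) ^ 2 < (ρ / 2 * X) ^ 2 := by
      rw [mul_pow _ X, mul_pow _ X, ← mul_assoc]
      exact mul_lt_mul_of_pos_right hηC (by positivity)
    linarith
  have h1 : ‖t - t₀‖ = 0 := by linarith [norm_nonneg (t - t₀), abs_nonneg s]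
  have h2 : |s| = 0 := by linarith [norm_nonneg (t - t₀), abs_nonneg s]
  exact ⟨sub_eq_zero.mp (norm_eq_zero.mp h1), abs_eq_zero.mp h2⟩

theorem polyFamily_eq_perturbed_sphere {M : Finset ({j // j ∉ S} →₀ ℕ)} {z : ι → ℝ} {ρ : ℝ}
    {t₁ : {j // j ∉ S} → ℝ} {w₀ b₀ : ι × M → ℝ}
    (hw₀ : ∀ t, polyFamily M w₀ t = z + extendZero S (ρ • (t - t₁)))
    (hb₀ : ∀ t, polyFamily M b₀ t = extendZero S t₁) {η : ℝ} (hη : 0 < η) :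
    ∃ ε > 0, ∀ w b t₀, ‖w - w₀‖ < ε → ‖b - b₀‖ < ε → ‖t₀ - t₁‖ < ε → ∑ j, t₀ j ^ 2 = 1 →
      polyFamily M w t₀ = z → ∀ t, ∑ j, t j ^ 2 = 1 → ∀ s : ℝ, ∃ e : ι → ℝ,
        ‖e‖ ≤ η * (‖t - t₀‖ + |s|) ∧
        polyFamily M (w + s • b) t = z + extendZero S (ρ • (t - t₀) + s • t₀) + e := by
  obtain ⟨L, hL, hLip⟩ := exists_polyFamily_lipschitz (ι := ι) M
  refine ⟨η / (L + 1), by positivity, fun w b t₀ hw hb htt ht₀ hz t ht s => ?_⟩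
  set ε := η / (L + 1) with hε
  have hεη : L * ε + ε = η := by rw [hε]; field_simp
  have hε0 : 0 < ε := by positivity
  refine ⟨polyFamily M (w - w₀) t - polyFamily M (w - w₀) t₀ + s • extendZero S (t₁ - t₀) +
    s • polyFamily M (b - b₀) t, ?_, ?_⟩
  · have h1 := (hLip (w - w₀) t t₀ (norm_le_one_of_sum_sq ht) (norm_le_one_of_sum_sq ht₀)).1
    have h2 := (hLip (b - b₀) t t₀ (norm_le_one_of_sum_sq ht) (norm_le_one_of_sum_sq ht₀)).2
    have h3 : L * ‖w - w₀‖ * ‖t - t₀‖ ≤ L * ε * ‖t - t₀‖ := by gcongr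
    have h4 : L * ‖b - b₀‖ ≤ L * ε := by gcongr
    have h5 : ‖s • extendZero S (t₁ - t₀)‖ ≤ |s| * ε := by
      rw [norm_smul, Real.norm_eq_abs]
      gcongr
      refine (norm_extendZero_le _).trans ?_
      rw [norm_sub_rev]
      exact htt.le
    have h6 : ‖s • polyFamily M (b - b₀) t‖ ≤ |s| * (L * ε) := by
      rw [norm_smul, Real.norm_eq_abs]
      gcongr
      exact h2.trans h4
    refine norm_add₃_le.trans ?_
    have h7 : L * ε * ‖t - t₀‖ ≤ η * ‖t - t₀‖ := by
      gcongr
      linarith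
    have h8 : |s| * ε + |s| * (L * ε) = η * |s| := by rw [← hεη]; ring
    linarith
  · have h1 : polyFamily M w₀ t₀ = z + extendZero S (ρ • (t₀ - t₁)) := hw₀ t₀
    simp only [polyFamily_add, polyFamily_smul, polyFamily_sub, hw₀, hb₀, hz, map_add, map_sub,
      map_smul, smul_sub]
    abel
end

section
variable {k : Type*} [Field k] [Algebra k ℝ]

theorem aeval_polyMap {κ ι : Type*} (G : κ → MvPolynomial ι k) (y : ι → ℝ)
    (Q : MvPolynomial κ k) : aeval (polyMap G y) Q = aeval y (bind₁ G Q) :=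
  (aeval_bind₁ _ _ _).symm

theorem SameType.polyMap {κ ι : Type*} {y y' : ι → ℝ} (h : SameType k y y')
    (G : κ → MvPolynomial ι k) : SameType k (polyMap G y) (polyMap G y') := fun Q => by
  rw [aeval_polyMap, aeval_polyMap, h]

theorem isAlgebraic_adjoin_mono {A B : Set ℝ} (hAB : A ⊆ B) {x : ℝ}
    (hx : IsAlgebraic (IntermediateField.adjoin k A) x) :
    IsAlgebraic (IntermediateField.adjoin k B) x := by
  let _ : Algebra (IntermediateField.adjoin k A) (IntermediateField.adjoin k B) :=
    (IntermediateField.inclusion (IntermediateField.adjoin.mono k A B hAB)).toAlgebra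
  have : IsScalarTower (IntermediateField.adjoin k A) (IntermediateField.adjoin k B) ℝ :=
    IsScalarTower.of_algebraMap_eq fun _ => rfl
  exact hx.tower_top _

variable {ι : Type*} [Fintype ι] {S : Set ι} [Fintype {j // j ∉ S}]
  {M : Finset ({j // j ∉ S} →₀ ℕ)}

omit [Fintype ι] in
theorem unique_point_of_sphere_relations {V : Set (ι → ℝ)} {R : ι → MvPolynomial ι k}
    (hV : V = {y | ∀ j ∉ S, aeval y (R j) = 0}) {w : ι × M → ℝ} {t₀ : {j // j ∉ S} → ℝ}
    (ht₀ : ∑ j, t₀ j ^ 2 = 1) (hz : polyFamily M w t₀ ∈ V)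
    (huniq : ∀ t, ∑ j, t j ^ 2 = 1 → polyFamily M w t ∈ V → t = t₀) (t : {j // j ∉ S} → ℝ)
    (h : ∀ Q : MvPolynomial ((ι × M) ⊕ {j // j ∉ S}) k,
      aeval (Sum.elim w t₀) Q = 0 → aeval (Sum.elim w t) Q = 0) : t = t₀ := by
  refine huniq t ?_ ?_
  · have := h (∑ j, X (Sum.inr j) ^ 2 - 1) (by simp [ht₀])
    simpa [sub_eq_zero] using this
  · rw [hV] at hz ⊢
    intro j hj
    have := h (bind₁ (universalPoly k M) (R j))
      (by rw [← aeval_polyMap, polyMap_universalPoly]; exact hz j hj)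
    rwa [← aeval_polyMap, polyMap_universalPoly] at this

omit [Fintype ι] in
theorem isAlgebraic_generic_family {z : ι → ℝ} {w a : ι × M → ℝ} {t₀ : {j // j ∉ S} → ℝ}
    (hz : polyFamily M w t₀ = z)
    (ht₀ : ∀ j, IsAlgebraic (IntermediateField.adjoin k (range w)) (t₀ j)) {r : ℝ}
    (haw : ∀ i, ∀ m : M, (m : {j // j ∉ S} →₀ ℕ) ≠ 0 → a (i, m) = w (i, m))
    (haz : ∀ i ∈ S, ∀ m : M, (m : {j // j ∉ S} →₀ ℕ) = 0 → a (i, m) = z i)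
    (har : ∀ j : {j // j ∉ S}, ∀ m : M, (m : {j // j ∉ S} →₀ ℕ) = 0 → a (j, m) = r * t₀ j)
    (x : ι × M) : IsAlgebraic (IntermediateField.adjoin k (insert r (range w))) (a x) := by
  obtain ⟨i, m⟩ := x
  let K := IntermediateField.adjoin k (insert r (range w))
  have hK : ∀ y ∈ insert r (range w), IsAlgebraic K y := fun y hy =>
    isAlgebraic_algebraMap (⟨y, IntermediateField.subset_adjoin _ _ hy⟩ : K)
  have hw : ∀ y, IsAlgebraic K (w y) := fun y => hK _ (Or.inr ⟨y, rfl⟩)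
  have ht : ∀ j, IsAlgebraic K (t₀ j) := fun j => isAlgebraic_adjoin_mono (subset_insert _ _) (ht₀ j)
  by_cases hm : (m : {j // j ∉ S} →₀ ℕ) = 0
  · by_cases hi : i ∈ S
    · rw [haz i hi m hm, ← hz]
      refine mem_algebraicClosure_iff.mp (sum_mem fun m _ => mul_mem
        (mem_algebraicClosure_iff.mpr (hw _)) (prod_mem fun j _ => pow_mem
          (mem_algebraicClosure_iff.mpr (ht j)) _))
    · rw [har ⟨i, hi⟩ m hm]
      exact (hK r (Or.inl rfl)).mul (ht _)
  · rw [haw i m hm]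
    exact hw _

theorem exists_generic_family [Countable k] {z : ι → ℝ}
    (hS : AlgebraicIndependent k fun i : S => z i) (h0 : 0 ∈ M) {w₀ : ι × M → ℝ}
    {t₁ : {j // j ∉ S} → ℝ} (ht₁ : ∑ j, t₁ j ^ 2 = 1) (hw₀ : polyFamily M w₀ t₁ = z) {ε : ℝ}
    (hε : 0 < ε) : ∃ (w a : ι × M → ℝ) (t₀ : {j // j ∉ S} → ℝ) (r : ℝ), ‖w - w₀‖ < ε ∧
      ‖t₀ - t₁‖ < ε ∧ ∑ j, t₀ j ^ 2 = 1 ∧ polyFamily M w t₀ = z ∧ AlgebraicIndependent k a ∧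
      (∀ i, ∀ m : M, (m : {j // j ∉ S} →₀ ℕ) ≠ 0 → a (i, m) = w (i, m)) ∧
      (∀ i ∈ S, ∀ m : M, (m : {j // j ∉ S} →₀ ℕ) = 0 → a (i, m) = z i) ∧
      ∀ j : {j // j ∉ S}, ∀ m : M, (m : {j // j ∉ S} →₀ ℕ) = 0 → a (j, m) = r * t₀ j := by
  classical
  let o : M := ⟨0, h0⟩
  have ho : ∀ m : M, (m : {j // j ∉ S} →₀ ℕ) = 0 ↔ m = o := fun m => by simp [o, Subtype.ext_iff]
  simp only [ne_eq, ho]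
  let v : ι × M → ℝ := fun x =>
    if x.2 = o then (if h : x.1 ∈ S then z x.1 else t₁ ⟨x.1, h⟩) else w₀ x
  let nrm : (ι × M → ℝ) → ℝ := fun a => √(∑ j : {j // j ∉ S}, a (j, o) ^ 2)
  let t : (ι × M → ℝ) → {j // j ∉ S} → ℝ := fun a j => (nrm a)⁻¹ * a (j, o)
  let W : (ι × M → ℝ) → ι × M → ℝ := fun a x => if x.2 = o then
    z x.1 - ∑ m ∈ Finset.univ.erase o, a (x.1, m) * ∏ j, t a j ^ (m : {j // j ∉ S} →₀ ℕ) j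
    else a x
  have hvt : ∀ j : {j // j ∉ S}, v (j, o) = t₁ j := fun j => by simp [v, j.2]
  have hnv : nrm v = 1 := by simp [nrm, hvt, ht₁]
  have htv : t v = t₁ := by
    funext j
    simp [t, hnv, hvt]
  have hfam : ∀ (u : ι × M → ℝ) (t' : {j // j ∉ S} → ℝ) i, polyFamily M u t' i = u (i, o) +
      ∑ m ∈ Finset.univ.erase o, u (i, m) * ∏ j, t' j ^ (m : {j // j ∉ S} →₀ ℕ) j := fun u t' i => by
    rw [polyFamily, ← Finset.add_sum_erase _ _ (Finset.mem_univ o)]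
    simp [o]
  have hWv : W v = w₀ := by
    funext ⟨i, m⟩
    by_cases hm : m = o
    · have h1 := congrFun hw₀ i
      rw [hfam] at h1
      have h2 : ∑ m ∈ Finset.univ.erase o, v (i, m) * ∏ j, t v j ^ (m : {j // j ∉ S} →₀ ℕ) j =
          ∑ m ∈ Finset.univ.erase o, w₀ (i, m) * ∏ j, t₁ j ^ (m : {j // j ∉ S} →₀ ℕ) j := by
        refine Finset.sum_congr rfl fun m hm => ?_
        rw [htv]
        simp [v, Finset.ne_of_mem_erase hm]
      simp only [W, hm, if_true]
      rw [h2, ← h1]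
      ring
    · simp [W, v, hm]
  have hnc : Continuous nrm := by fun_prop
  have htc : ContinuousAt t v := by
    refine continuousAt_pi.mpr fun j => ?_
    exact (hnc.continuousAt.inv₀ (by rw [hnv]; exact one_ne_zero)).mul
      (continuous_apply _).continuousAt
  have hWc : ContinuousAt W v := by
    refine continuousAt_pi.mpr fun x => ?_
    by_cases hx : x.2 = o
    · simp only [W, hx, if_true]
      refine continuousAt_const.sub (tendsto_finsetSum _ fun m _ => ?_)
      refine (continuous_apply _).continuousAt.mul (tendsto_finsetProd _ fun j _ => ?_)
      exact (continuousAt_pi.mp htc j).pow _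
    · simp only [W, hx, if_false]
      exact (continuous_apply _).continuousAt
  have hP : AlgebraicIndependent k fun x : {x : ι × M | x.1 ∈ S ∧ x.2 = o} => v x := by
    have h1 : Function.Injective fun x : {x : ι × M | x.1 ∈ S ∧ x.2 = o} =>
        (⟨x.1.1, x.2.1⟩ : S) := fun x y hxy => by
      refine Subtype.ext (Prod.ext (congrArg Subtype.val hxy) (x.2.2.trans y.2.2.symm))
    convert hS.comp _ h1 using 1
    funext x
    simp [v, x.2.1, x.2.2]
  have hN1 : ∀ᶠ a in 𝓝 v, ‖W a - w₀‖ < ε := by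
    have := hWc.eventually (Metric.ball_mem_nhds _ hε)
    simpa [hWv, dist_eq_norm] using this
  have hN2 : ∀ᶠ a in 𝓝 v, ‖t a - t₁‖ < ε := by
    have := htc.eventually (Metric.ball_mem_nhds _ hε)
    simpa [htv, dist_eq_norm] using this
  have hN3 : ∀ᶠ a in 𝓝 v, nrm a ≠ 0 :=
    hnc.continuousAt.eventually_ne (by rw [hnv]; exact one_ne_zero)
  obtain ⟨a, ⟨⟨ha1, ha2⟩, ha3⟩, haP, hai⟩ := exists_generic_extension hP
    ((hN1.and hN2).and hN3)
  refine ⟨W a, a, t a, nrm a, ha1, ha2, ?_, ?_, hai, ?_, ?_, ?_⟩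
  · have h1 : nrm a ^ 2 = ∑ j : {j // j ∉ S}, a (j, o) ^ 2 := Real.sq_sqrt (by positivity)
    simp only [t, mul_pow, ← Finset.mul_sum, ← h1]
    rw [← mul_pow, inv_mul_cancel₀ ha3, one_pow]
  · funext i
    rw [hfam]
    have h2 : ∑ m ∈ Finset.univ.erase o, W a (i, m) * ∏ j, t a j ^ (m : {j // j ∉ S} →₀ ℕ) j =
        ∑ m ∈ Finset.univ.erase o, a (i, m) * ∏ j, t a j ^ (m : {j // j ∉ S} →₀ ℕ) j := by
      refine Finset.sum_congr rfl fun m hm => ?_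
      simp [W, Finset.ne_of_mem_erase hm]
    rw [h2]
    simp [W]
  · intro i m hm
    simp [W, hm]
  · rintro i hi m rfl
    rw [haP (i, o) ⟨hi, rfl⟩]
    simp [v, hi]
  · rintro j m rfl
    simp only [t]
    rw [mul_inv_cancel_left₀ ha3]
end

section
variable {k : Type*} [Field k] [Algebra k ℝ]

theorem polyMap_map_algebraMap {κ ι : Type*} (F : κ → MvPolynomial ι k) :
    polyMap (fun i => MvPolynomial.map (algebraMap k ℝ) (F i)) = polyMap F := by
  funext x i
  simp [polyMap, aeval_map_algebraMap]

/-- A preconnected set leaving a closed set that contains the generic points of a hypersurface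
cannot join the two ends of a segment crossing the hypersurface transversally. -/
theorem IsPreconnected.not_joins_of_transversal [Countable k] {κ : Type*} [Fintype κ]
    {Γ : Set (κ → ℝ)} (hΓ : IsPreconnected Γ) {H : MvPolynomial κ k} (hH : Irreducible H)
    {Z : Set (κ → ℝ)} (hZ : IsClosed Z)
    (hgen : ∀ w, (∀ g : MvPolynomial κ k, aeval w g = 0 ↔ H ∣ g) → w ∈ Z)
    (hΓZ : ∀ w ∈ Γ, w ∉ Z) {w b : κ → ℝ} (hw : aeval w H = 0) (hb : H.fderivAt w b ≠ 0) {δ : ℝ}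
    (hδ : 0 < δ) (hray : ∀ s : ℝ, s ≠ 0 → |s| ≤ δ → w + s • b ∉ Z) (hpos : w + δ • b ∈ Γ)
    (hneg : w + (-δ) • b ∈ Γ) : False := by
  let f : ℝ → ℝ := fun s => aeval (w + s • b) H
  have hline : Continuous fun s : ℝ => w + s • b := by fun_prop
  have hf : HasDerivAt f (H.fderivAt w b) 0 := by
    have h1 : HasDerivAt (fun s : ℝ => w + s • b) b 0 := by
      simpa using ((hasDerivAt_id (0 : ℝ)).smul_const b).const_add w
    have h2 := (H.hasStrictFDerivAt_aeval w).hasFDerivAt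
    exact HasFDerivAt.comp_hasDerivAt (x := (0 : ℝ)) (by simpa using h2) h1
  have hf0 : f 0 = 0 := by simp [f, hw]
  obtain ⟨s, hs0, hsδ, hs⟩ : ∃ s, 0 < s ∧ s ≤ δ ∧ f s * f (-s) < 0 := by
    have h1 := hf.tendsto_slope_zero
    simp only [zero_add, hf0, sub_zero, smul_eq_mul] at h1
    have h2 : Tendsto (fun s : ℝ => s⁻¹ * f s) (𝓝[>] 0) (𝓝 (H.fderivAt w b)) :=
      h1.mono_left (nhdsWithin_mono _ fun s hs => (ne_of_gt hs))
    have h3 : Tendsto (fun s : ℝ => (-s)⁻¹ * f (-s)) (𝓝[>] 0) (𝓝 (H.fderivAt w b)) := by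
      refine h1.comp (tendsto_nhdsWithin_iff.mpr ⟨?_, ?_⟩)
      · have : Continuous fun s : ℝ => -s := continuous_neg
        simpa using (this.tendsto 0).mono_left nhdsWithin_le_nhds
      · filter_upwards [self_mem_nhdsWithin] with s hs
        exact neg_ne_zero.mpr (ne_of_gt hs)
    have h4 := (h2.mul h3).eventually (lt_mem_nhds (mul_self_pos.mpr hb))
    obtain ⟨s, hs, hs0, hsδ⟩ := (h4.and (Ioc_mem_nhdsGT hδ)).exists
    refine ⟨s, hs0, hsδ, ?_⟩
    have h5 : s⁻¹ * f s * ((-s)⁻¹ * f (-s)) = -((s⁻¹) ^ 2 * (f s * f (-s))) := by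
      rw [inv_neg]
      ring
    rw [h5] at hs
    have h6 : 0 < s⁻¹ ^ 2 := by positivity
    nlinarith
  have hray' : ∀ a : ℝ, ∀ ε : ℝ, ε = 1 ∨ ε = -1 → a ∈ Ioc 0 δ → w + (ε * a) • b ∉ Z := by
    rintro a ε hε ⟨ha, haδ⟩
    refine hray _ ?_ ?_
    · rcases hε with rfl | rfl <;> simp [ha.ne']
    · rcases hε with rfl | rfl <;> simpa [abs_of_pos ha]
  have himg : ∀ ε : ℝ, IsPreconnected ((fun a : ℝ => w + (ε * a) • b) '' Ioc 0 δ) := fun ε =>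
    isPreconnected_Ioc.image _ (by fun_prop)
  have hδ' : δ ∈ Ioc 0 δ := ⟨hδ, le_rfl⟩
  have hs' : s ∈ Ioc 0 δ := ⟨hs0, hsδ⟩
  have hend : ∀ ε : ℝ, ∀ {c : ℝ}, ε * δ = c →
      w + c • b ∈ (fun a : ℝ => w + (ε * a) • b) '' Ioc 0 δ := fun ε c h => ⟨δ, hδ', by rw [← h]⟩
  have hpre := (IsPreconnected.union (w + δ • b) (hend 1 (one_mul δ)) hpos (himg 1)
    hΓ).union (w + (-δ) • b) (Or.inr hneg) (hend (-1) (neg_one_mul δ)) (himg (-1))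
  have hsp : w + s • b ∈ (fun a : ℝ => w + (1 * a) • b) '' Ioc 0 δ ∪ Γ ∪
      (fun a : ℝ => w + (-1 * a) • b) '' Ioc 0 δ := Or.inl (Or.inl ⟨s, hs', by simp⟩)
  have hsn : w + (-s) • b ∈ (fun a : ℝ => w + (1 * a) • b) '' Ioc 0 δ ∪ Γ ∪
      (fun a : ℝ => w + (-1 * a) • b) '' Ioc 0 δ := Or.inr ⟨s, hs', by simp⟩
  have hdis : ∀ v ∈ (fun a : ℝ => w + (1 * a) • b) '' Ioc 0 δ ∪ Γ ∪
      (fun a : ℝ => w + (-1 * a) • b) '' Ioc 0 δ, v ∉ Z := by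
    rintro v ((⟨a, ha, rfl⟩ | hv) | ⟨a, ha, rfl⟩)
    · exact hray' a 1 (Or.inl rfl) ha
    · exact hΓZ v hv
    · exact hray' a (-1) (Or.inr rfl) ha
  rcases mul_neg_iff.mp hs with ⟨h1, h2⟩ | ⟨h1, h2⟩
  · exact hpre.not_exists_sign_change hH hZ hgen hdis hsn hsp h2 h1
  · exact hpre.not_exists_sign_change hH hZ hgen hdis hsp hsn h1 h2

variable {ι : Type*} [Fintype ι] {S : Set ι} [Fintype {j // j ∉ S}]

/-- Meeting the complement of the range of an injective polynomial map in a single point is a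
property of the type of a family of spheres. -/
theorem exists_sphere_mem_of_sameType [Countable k] {M : Finset ({j // j ∉ S} →₀ ℕ)}
    {F : ι → MvPolynomial ι k} (hF : Function.Injective (polyMap F)) {V : Set (ι → ℝ)}
    {R : ι → MvPolynomial ι k} (hV : V = {y | ∀ j ∉ S, aeval y (R j) = 0}) {w w' : ι × M → ℝ} (h : SameType k w w')
    {t₀ : {j // j ∉ S} → ℝ} (ht₀ : ∑ j, t₀ j ^ 2 = 1)
    (hz : polyFamily M w t₀ ∈ V) (hzF : polyFamily M w t₀ ∉ range (polyMap F))
    (huniq : ∀ t, ∑ j, t j ^ 2 = 1 → polyFamily M w t ∈ V → t = t₀) :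
    ∃ t ∈ {t : {j // j ∉ S} → ℝ | ∑ j, t j ^ 2 = 1},
      polyFamily M w' t ∈ (range (polyMap F))ᶜ ∩ V := by
  obtain ⟨t, ht⟩ := exists_sameType_of_unique_point
    (unique_point_of_sphere_relations hV ht₀ hz huniq) h
  have hfam := ht.polyMap (universalPoly k M)
  rw [polyMap_universalPoly, polyMap_universalPoly] at hfam
  refine ⟨t, ?_, fun hU => hzF (hfam.symm.mem_range_polyMap hF hU), ?_⟩
  · have := (ht (∑ j, X (Sum.inr j) ^ 2 - 1)).mp (by simp [ht₀])
    simpa [sub_eq_zero] using this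
  · rw [hV] at hz ⊢
    exact fun j hj => (hfam _).mp (hz j hj)

omit [Fintype ι] in
theorem isCompact_setOf_sum_sq_eq_one {σ : Type*} [Fintype σ] :
    IsCompact {t : σ → ℝ | ∑ j, t j ^ 2 = 1} := by
  refine Metric.isCompact_of_isClosed_isBounded
    (isClosed_eq (by fun_prop) continuous_const) ?_
  exact isBounded_iff_forall_norm_le.mpr ⟨1, fun t ht => norm_le_one_of_sum_sq ht⟩

/-- The coefficients of two families of spheres avoiding a missed point of an injective polynomial
map can be joined through families mapping into its range. -/
theorem exists_joined_families [Countable k] [CharZero k] {F : ι → MvPolynomial ι k}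
    (hF : Function.Injective (polyMap F)) (z : ι → ℝ) (t₁ : {j // j ∉ S} → ℝ) {ρ δ : ℝ}
    (hpos : ∀ t, ∑ j, t j ^ 2 = 1 →
      z + extendZero S (ρ • (t - t₁) + δ • t₁) ∈ range (polyMap F))
    (hneg : ∀ t, ∑ j, t j ^ 2 = 1 →
      z + extendZero S (ρ • (t - t₁) - δ • t₁) ∈ range (polyMap F)) :
    ∃ (M : Finset ({j // j ∉ S} →₀ ℕ)) (w₀ b₀ : ι × M → ℝ) (Γ : Set (ι × M → ℝ)), 0 ∈ M ∧
      (∀ t, polyFamily M w₀ t = z + extendZero S (ρ • (t - t₁))) ∧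
      (∀ t, polyFamily M b₀ t = extendZero S t₁) ∧ IsPreconnected Γ ∧ w₀ + δ • b₀ ∈ Γ ∧
      w₀ - δ • b₀ ∈ Γ ∧
      ∀ w ∈ Γ, ∀ t, ∑ j, t j ^ 2 = 1 → polyFamily M w t ∈ range (polyMap F) := by
  classical
  let p₀ : ι → MvPolynomial {j // j ∉ S} ℝ := fun i =>
    C (z i - ρ * extendZero S t₁ i) + if h : i ∉ S then C ρ * X ⟨i, h⟩ else 0
  let β : ι → MvPolynomial {j // j ∉ S} ℝ := fun i => C (extendZero S t₁ i)
  have hp₀ : ∀ t, (fun i => eval t (p₀ i)) = z + extendZero S (ρ • (t - t₁)) := fun t => by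
    funext i
    by_cases h : i ∈ S
    · simp [p₀, h, extendZero_of_mem]
    · have h1 := fun v => extendZero_of_notMem (S := S) v ⟨i, h⟩
      simp only [Pi.add_apply, h1]
      simp [p₀, h, h1]
      ring
  have hβ : ∀ t, (fun i => eval t (β i)) = extendZero S t₁ := fun t => by
    funext i
    simp [β]
  let q : ℝ → ι → MvPolynomial {j // j ∉ S} ℝ := fun c i => p₀ i + C c * β i
  have hq : ∀ c t, (fun i => eval t (q c i)) =
      z + extendZero S (ρ • (t - t₁) + c • t₁) := fun c t => by
    rw [map_add, map_smul _ c, ← add_assoc, ← hp₀, ← hβ t]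
    funext i
    simp [q]
  let Φ : ι → MvPolynomial ι ℝ := fun i => MvPolynomial.map (algebraMap k ℝ) (F i)
  have hΦ : polyMap Φ = polyMap F := polyMap_map_algebraMap F
  obtain ⟨N, hN⟩ := exists_preconnected_coeffs (Φ := Φ)
    (by rw [hΦ]; exact isOpenEmbedding_polyMap hF)
    (isCompact_setOf_sum_sq_eq_one (σ := {j // j ∉ S})) (p := q δ) (q := q (-δ))
    (fun t ht => by rw [hΦ, hq]; exact hpos t ht)
    (fun t ht => by
      rw [hΦ, hq, neg_smul, ← sub_eq_add_neg]
      exact hneg t ht)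
  let M := insert 0 (N ∪ (Finset.univ.biUnion (fun i => (p₀ i).support) ∪
    Finset.univ.biUnion fun i => (β i).support))
  have hNM : N ⊆ M := fun m hm => by simp [M, hm]
  have hpM : ∀ i, (p₀ i).support ⊆ M := fun i m hm => by
    simp only [M, Finset.mem_insert, Finset.mem_union, Finset.mem_biUnion, Finset.mem_univ,
      true_and]
    exact Or.inr (Or.inr (Or.inl ⟨i, hm⟩))
  have hβM : ∀ i, (β i).support ⊆ M := fun i m hm => by
    simp only [M, Finset.mem_insert, Finset.mem_union, Finset.mem_biUnion, Finset.mem_univ,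
      true_and]
    exact Or.inr (Or.inr (Or.inr ⟨i, hm⟩))
  obtain ⟨Γ, hΓ, h1, h2, h3⟩ := hN M hNM
  have hcoeff : ∀ c, coeffVector M (q c) = coeffVector M p₀ + c • coeffVector M β := fun c => by
    funext x
    simp [coeffVector, q]
  rw [hΦ] at h3
  rw [hcoeff] at h1 h2
  refine ⟨M, coeffVector M p₀, coeffVector M β, Γ, by simp [M], fun t => ?_, fun t => ?_, hΓ, h1,
    ?_, h3⟩
  · rw [polyFamily_coeffVector hpM, hp₀]
  · rw [polyFamily_coeffVector hβM, hβ]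
  · rwa [sub_eq_add_neg, ← neg_smul]
end

section
variable {k : Type*} [Field k] [Algebra k ℝ] [Countable k] {ι : Type*} [Fintype ι] {S : Set ι}
  [Fintype {j // j ∉ S}]

/-- A family of spheres meeting the variety `V` exactly in a missed point of `F`, together with a
transversal direction and a way to join its two sides, cannot exist. -/
theorem false_of_joined_families [CharZero k] {F : ι → MvPolynomial ι k}
    (hF : Function.Injective (polyMap F)) {z : ι → ℝ} (hz : z ∉ range (polyMap F))
    (hS : AlgebraicIndependent k fun i : S => z i) {R : ι → MvPolynomial ι k} {V : Set (ι → ℝ)}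
    (hV : V = {y | ∀ j ∉ S, aeval y (R j) = 0}) (hzV : z ∈ V) {M : Finset ({j // j ∉ S} →₀ ℕ)}
    (h0 : 0 ∈ M) {w₀ b₀ : ι × M → ℝ} {t₁ : {j // j ∉ S} → ℝ} (ht₁ : ∑ j, t₁ j ^ 2 = 1)
    (hw₀ : polyFamily M w₀ t₁ = z) {Γ : Set (ι × M → ℝ)} (hΓ : IsPreconnected Γ) {δ : ℝ}
    (hδ : 0 < δ) (hpos : w₀ + δ • b₀ ∈ Γ) (hneg : w₀ - δ • b₀ ∈ Γ)
    (hΓF : ∀ w ∈ Γ, ∀ t, ∑ j, t j ^ 2 = 1 → polyFamily M w t ∈ range (polyMap F)) {ε : ℝ}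
    (hε : 0 < ε)
    (hgeom : ∀ w b t₀, ‖w - w₀‖ < ε → ‖b - b₀‖ < ε → ‖t₀ - t₁‖ < ε → ∑ j, t₀ j ^ 2 = 1 →
      polyFamily M w t₀ = z → ∀ t, ∑ j, t j ^ 2 = 1 → ∀ s : ℝ, |s| ≤ δ →
      polyFamily M (w + s • b) t ∈ V → t = t₀ ∧ s = 0) : False := by
  have hU : IsOpen (range (polyMap F)) := (isOpenEmbedding_polyMap hF).isOpen_range
  have hVc : IsClosed V := by
    have h1 : V = ⋂ j, ⋂ (_ : j ∉ S), {y | aeval y (R j) = 0} := by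
      rw [hV]
      ext y
      simp
    rw [h1]
    exact isClosed_iInter fun j => isClosed_iInter fun _ =>
      isClosed_eq (R j).continuous_aeval continuous_const
  have hT := isCompact_setOf_sum_sq_eq_one (σ := {j // j ∉ S})
  have hO := isOpen_setOf_polyFamily_mem M hT hU
  have hZ := isClosed_setOf_polyFamily_mem M hT (hU.isClosed_compl.inter hVc)
  set Z := {w | ∃ t ∈ {t : {j // j ∉ S} → ℝ | ∑ j, t j ^ 2 = 1},
    polyFamily M w t ∈ (range (polyMap F))ᶜ ∩ V} with hZdef
  set O := {w | ∀ t ∈ {t : {j // j ∉ S} → ℝ | ∑ j, t j ^ 2 = 1},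
    polyFamily M w t ∈ range (polyMap F)} with hOdef
  have hOZ : ∀ w ∈ O, w ∉ Z := fun w hw ⟨t, ht, htU, _⟩ => htU (hw t ht)
  obtain ⟨r₁, hr₁, hball₁⟩ := Metric.isOpen_iff.mp hO _ (hΓF _ hpos)
  obtain ⟨r₂, hr₂, hball₂⟩ := Metric.isOpen_iff.mp hO _ (hΓF _ hneg)
  set ε' := min ε (min r₁ r₂ / (1 + δ)) with hε'def
  have hε' : 0 < ε' := by positivity
  have hεr : ε' + δ * ε' ≤ min r₁ r₂ := by
    have h1 : ε' ≤ min r₁ r₂ / (1 + δ) := min_le_right _ _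
    rw [le_div_iff₀ (by positivity)] at h1
    linarith
  obtain ⟨w, a, t₀, r, hw, htt, ht₀, hwz, ha, haw, haz, har⟩ :=
    exists_generic_family hS h0 ht₁ hw₀ hε'
  have hwε : ‖w - w₀‖ < ε := hw.trans_le (min_le_left _ _)
  have httε : ‖t₀ - t₁‖ < ε := htt.trans_le (min_le_left _ _)
  have huniq : ∀ t, ∑ j, t j ^ 2 = 1 → polyFamily M w t ∈ V → t = t₀ := fun t ht htV =>
    (hgeom w b₀ t₀ hwε (by simpa) httε ht₀ hwz t ht 0 (by simpa using hδ.le) (by simpa)).1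
  have htype : ∀ {w'}, SameType k w w' → w' ∈ Z := fun h =>
    exists_sphere_mem_of_sameType hF hV h ht₀ (by rwa [hwz]) (by rwa [hwz]) huniq
  have hwai : ¬ AlgebraicIndependent k w := fun hwai => by
    obtain ⟨w', hw', hw'O⟩ := (dense_algebraicIndependent k (ι × M)).exists_mem_open hO
      ⟨_, hΓF _ hpos⟩
    exact hOZ w' hw'O (htype (.of_algebraicIndependent hwai hw'))
  have htalg := isAlgebraic_of_unique_point
    (unique_point_of_sphere_relations hV ht₀ (by rwa [hwz]) huniq)
  obtain ⟨H, hH, hHw, hHd⟩ := exists_generic_hypersurface ha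
    (isAlgebraic_generic_family hwz htalg haw haz har) hwai
  obtain ⟨b, hb, hHb⟩ := exists_not_ker_mem_open hHd (Metric.isOpen_ball (x := b₀) (ε := ε'))
    ⟨b₀, Metric.mem_ball_self hε'⟩
  rw [mem_ball_iff_norm] at hb
  have hdist : ∀ s : ℝ, |s| = δ → ‖w + s • b - (w₀ + s • b₀)‖ < min r₁ r₂ := fun s hs => by
    have h1 : w + s • b - (w₀ + s • b₀) = (w - w₀) + s • (b - b₀) := by
      rw [smul_sub]
      abel
    rw [h1]
    refine (norm_add_le _ _).trans_lt ?_
    rw [norm_smul, Real.norm_eq_abs, hs]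
    nlinarith
  have hpre := ((convex_ball (w₀ + δ • b₀) r₁).isPreconnected.union (w₀ + δ • b₀)
    (Metric.mem_ball_self hr₁) hpos hΓ).union (w₀ - δ • b₀) (Or.inr hneg)
    (Metric.mem_ball_self hr₂) (convex_ball (w₀ - δ • b₀) r₂).isPreconnected
  refine hpre.not_joins_of_transversal hH hZ
    (fun w' hw' => htype fun g => (hHw g).trans (hw' g).symm) ?_ ((hHw H).mpr dvd_rfl) hHb hδ ?_
    (Or.inl (Or.inl ?_)) (Or.inr ?_)
  · rintro v ((hv | hv) | hv)
    exacts [hOZ v (hball₁ hv), hOZ v (hΓF v hv), hOZ v (hball₂ hv)]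
  · rintro s hs0 hsδ ⟨t, ht, -, htV⟩
    exact hs0 (hgeom w b t₀ hwε (hb.trans_le (min_le_left _ _)) httε ht₀ hwz t ht s hsδ htV).2
  · rw [mem_ball_iff_norm]
    exact (hdist δ (abs_of_pos hδ)).trans_le (min_le_left _ _)
  · rw [mem_ball_iff_norm, sub_eq_add_neg w₀, ← neg_smul]
    exact (hdist (-δ) (by rw [abs_neg, abs_of_pos hδ])).trans_le (min_le_right _ _)
end

/-- An injective polynomial map with coefficients in a countable field is surjective. -/
theorem surjective_polyMap_of_injective {k : Type*} [Field k] [Algebra k ℝ] [Countable k]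
    [CharZero k] {ι : Type*} [Fintype ι] {F : ι → MvPolynomial ι k}
    (hF : Function.Injective (polyMap F)) : Function.Surjective (polyMap F) := by
  classical
  by_contra hsurj
  have hne : ((range (polyMap F))ᶜ).Nonempty :=
    nonempty_compl.mpr fun h => hsurj (range_eq_univ.mp h)
  obtain ⟨z, hz, S, hS, hSu, hmax⟩ := exists_maximal_notMem_range hF hne
  obtain ⟨R, hR, C, hC, hRC⟩ := exists_relations_lipschitz hS (hmax z hz fun _ _ => rfl)
  obtain ⟨r, hr, hball⟩ := Metric.eventually_nhds_iff_ball.mp hRC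
  obtain ⟨j₀, hj₀⟩ := (ne_univ_iff_exists_notMem S).mp hSu
  let t₁ : {j // j ∉ S} → ℝ := Pi.single ⟨j₀, hj₀⟩ 1
  have ht₁ : ∑ j, t₁ j ^ 2 = 1 := by simp [t₁, Pi.single_apply, ite_pow]
  let ρ := min 1 (r / 4)
  have hρ : 0 < ρ := by positivity
  have hρ1 : ρ ≤ 1 := min_le_left _ _
  have hρr : 4 * ρ ≤ r := by linarith [min_le_right 1 (r / 4)]
  obtain ⟨η, hη, hηρ, hηC⟩ : ∃ η : ℝ, 0 < η ∧ 6 * η ≤ ρ ∧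
      Fintype.card {j // j ∉ S} * ((C + 1) * η) ^ 2 < (ρ / 2) ^ 2 := by
    have h1 : ∀ᶠ η in 𝓝 (0 : ℝ), 6 * η < ρ :=
      (by fun_prop : Continuous fun η : ℝ => 6 * η).continuousAt.eventually
        (gt_mem_nhds (by simpa))
    have h2 : ∀ᶠ η in 𝓝 (0 : ℝ),
        Fintype.card {j // j ∉ S} * ((C + 1) * η) ^ 2 < (ρ / 2) ^ 2 :=
      (by fun_prop : Continuous fun η : ℝ =>
        Fintype.card {j // j ∉ S} * ((C + 1) * η) ^ 2).continuousAt.eventually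
        (gt_mem_nhds (by beta_reduce; rw [mul_zero, zero_pow two_ne_zero, mul_zero]; positivity))
    obtain ⟨η, ⟨h1, h2⟩, h3⟩ := (((h1.and h2).filter_mono nhdsWithin_le_nhds).and
      (self_mem_nhdsWithin : Ioi 0 ∈ 𝓝[>] (0 : ℝ))).exists
    exact ⟨η, h3, h1.le, h2⟩
  have hE : {v | z + extendZero S v ∉ range (polyMap F)}.Countable := by
    have h1 := countable_setOf_algebraic_fibre hS (E := {y | y ∉ range (polyMap F) ∧
      ∀ i ∈ S, y i = z i}) fun y hy => ⟨hy.2, hmax y hy.1 hy.2⟩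
    have hinj : Function.Injective fun v : {j // j ∉ S} → ℝ => z + extendZero S v := by
      intro v v' h
      funext j
      simpa only [extendZero_of_notMem] using congrFun (add_left_cancel h) (j : ι)
    refine (h1.preimage hinj).mono ?_
    intro v hv
    exact ⟨hv, fun i hi => by simp [extendZero_of_mem v hi]⟩
  obtain ⟨δ, hδ, hδρ, havoid⟩ := exists_offset_avoiding ht₁ hE hρ
  simp only [mem_ofPred_eq, not_not] at havoid
  obtain ⟨M, w₀, b₀, Γ, h0, hw₀, hb₀, hΓ, hpos, hneg, hΓF⟩ := exists_joined_families hF z t₁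
    (fun t ht => (havoid t ht).1) fun t ht => (havoid t ht).2
  obtain ⟨ε, hε, hfam⟩ := polyFamily_eq_perturbed_sphere hw₀ hb₀ hη
  refine false_of_joined_families hF hz hS (R := R) rfl hR h0 ht₁ (by simp [hw₀]) hΓ hδ hpos
    hneg hΓF hε fun w b t₀ hw hb htt ht₀ hwz t ht s hs htV => ?_
  obtain ⟨e, he, heq⟩ := hfam w b t₀ hw hb htt ht₀ hwz t ht s
  rw [heq] at htV
  exact eq_of_mem_perturbed_sphere
    (fun y hy hyr c hc => hball y (mem_ball_iff_norm.mpr hyr) hy c hc) hρ hρ1 hρr hη hηρ hηC ht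
    ht₀ (hs.trans hδρ.le) he htV

theorem surjective_of_injective_eval {n : ℕ} (P : Fin n → MvPolynomial (Fin n) ℝ)
    (hinj : Function.Injective fun x : Fin n → ℝ => fun i => eval x (P i)) :
    Function.Surjective fun x : Fin n → ℝ => fun i => eval x (P i) := by
  let c : (Σ i, ((P i).support : Set (Fin n →₀ ℕ))) → ℝ := fun x => (P x.1).coeff x.2
  let k := IntermediateField.adjoin ℚ (range c)
  have : Countable k := countable_adjoin_range c
  have hP : ∀ i, ∃ p : MvPolynomial (Fin n) k, MvPolynomial.map (algebraMap k ℝ) p = P i := by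
    intro i
    refine mem_range_map_iff_coeffs_subset.mpr ?_
    intro a ha
    obtain ⟨m, hm, rfl⟩ := mem_coeffs_iff.mp ha
    exact ⟨⟨_, IntermediateField.subset_adjoin ℚ _ ⟨⟨i, m, hm⟩, rfl⟩⟩, rfl⟩
  choose F hFP using hP
  have hF : polyMap F = fun x : Fin n → ℝ => fun i => eval x (P i) := by
    funext x i
    rw [← hFP, eval_map]
    rfl
  rw [← hF] at hinj ⊢
  exact surjective_polyMap_of_injective hinj

end

/-- Every injective polynomial mapping F : ℝⁿ → ℝⁿ is surjective,
hence bijective. -/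
theorem stmt_5 (n : ℕ) (P : Fin n → MvPolynomial (Fin n) ℝ)
    (hinj : Function.Injective (fun x : Fin n → ℝ => fun i => eval x (P i))) :
    Function.Surjective (fun x : Fin n → ℝ => fun i => eval x (P i)) ∧
    Function.Bijective (fun x : Fin n → ℝ => fun i => eval x (P i)) := by
  have hsurj := surjective_of_injective_eval P hinj
  exact ⟨hsurj, hinj, hsurj⟩
end

section
/- Let F : ℝⁿ → ℝⁿ be a polynomial mapping such that det JF(x) ≠ 0 for every x ∈ ℝⁿ. Then for every a ∈ ℝⁿ, every solution of F(x) = a is an isolated point of the fiber F⁻¹(a), the fiber F⁻¹(a) is finite, and its cardinality satisfies #{x ∈ ℝⁿ : F(x) = a} ≤ (deg F₁)·(deg F₂)⋯(deg Fₙ), where deg F_i denotes the total degree of the polynomial F_i. -/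
open MvPolynomial

namespace MvPolynomial

section Field

variable {σ K : Type*} [Fintype σ] [Field K]

/-- The span of the monomials whose exponent of `X i` is smaller than `d i` for every `i`. -/
noncomputable def boxSpan (K : Type*) [Field K] (d : σ → ℕ) : Submodule K (MvPolynomial σ K) :=
  Submodule.span K (Set.range fun f : ∀ i, Fin (d i) =>
    monomial (Finsupp.equivFunOnFinite.symm fun i => (f i : ℕ)) 1)

theorem monomial_mem_boxSpan {d : σ → ℕ} {β : σ →₀ ℕ} (h : ∀ i, β i < d i) :
    monomial β (1 : K) ∈ boxSpan K d := by
  refine Submodule.subset_span ⟨fun i => ⟨β i, h i⟩, ?_⟩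
  exact congrArg (monomial · 1) (Finsupp.ext fun _ => rfl)

theorem finrank_boxSpan_le (d : σ → ℕ) : Module.finrank K (boxSpan K d) ≤ ∏ i, d i := by
  classical
  refine (finrank_range_le_card _).trans ?_
  simp

instance (d : σ → ℕ) : Module.Finite K (boxSpan K d) := by
  classical
  exact Module.Finite.span_of_finite K (Set.finite_range _)

/-- A linear map replacing, in each monomial that is divisible by some `X i ^ d i`, one such factor
by `Q i`, and killing the other monomials. -/
theorem exists_linearMap_replace_X_pow (d : σ → ℕ) (Q : σ → MvPolynomial σ K) :
    ∃ M : MvPolynomial σ K →ₗ[K] MvPolynomial σ K, ∀ β : σ →₀ ℕ,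
      (∃ i, d i ≤ β i ∧ M (monomial β 1) = monomial (β - Finsupp.single i (d i)) 1 * Q i) ∨
      ((∀ i, β i < d i) ∧ M (monomial β 1) = 0) := by
  classical
  refine ⟨(basisMonomials σ K).constr K fun β => if h : ∃ i, d i ≤ β i then
    monomial (β - Finsupp.single h.choose (d h.choose)) 1 * Q h.choose else 0, fun β => ?_⟩
  have key := (basisMonomials σ K).constr_basis K (fun β => if h : ∃ i, d i ≤ β i then
    monomial (β - Finsupp.single h.choose (d h.choose)) 1 * Q h.choose else 0) β
  rw [coe_basisMonomials] at key
  by_cases h : ∃ i, d i ≤ β i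
  · exact Or.inl ⟨h.choose, h.choose_spec, by rw [key, dif_pos h]⟩
  · exact Or.inr ⟨by simpa using h, by rw [key, dif_neg h]⟩

omit [Fintype σ] in
theorem restrictTotalDegree_le_of_monomial_mem {D : ℕ} {W : Submodule K (MvPolynomial σ K)}
    (h : ∀ β : σ →₀ ℕ, β.degree ≤ D → monomial β 1 ∈ W) : restrictTotalDegree σ K D ≤ W := by
  rw [restrictTotalDegree, restrictSupport_eq_span, Submodule.span_le]
  rintro _ ⟨β, hβ, rfl⟩
  exact h β hβ

/-- For all but finitely many `ε`, the monomials with exponents below `d` span the polynomial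
ring modulo the ideal generated by the `Q i + ε * X i ^ d i`, as soon as `deg Q i ≤ d i`. -/
theorem finite_setOf_boxSpan_sup_ne_top (d : σ → ℕ) (Q : σ → MvPolynomial σ K)
    (hQ : ∀ i, (Q i).totalDegree ≤ d i) :
    {ε : K | boxSpan K d ⊔
      (Ideal.span (Set.range fun i => Q i + C ε * X i ^ d i)).restrictScalars K ≠ ⊤}.Finite := by
  classical
  obtain ⟨M, hM⟩ := exists_linearMap_replace_X_pow d Q
  set D := ∑ i, d i + 1
  set V := restrictTotalDegree σ K D with hV
  have hMV : ∀ p ∈ V, M p ∈ V := by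
    suffices V ≤ V.comap M from this
    refine restrictTotalDegree_le_of_monomial_mem fun β hβ => ?_
    rw [Submodule.mem_comap]
    obtain ⟨i, hi, h⟩ | ⟨-, h⟩ := hM β
    · rw [h, hV, mem_restrictTotalDegree]
      have hle : Finsupp.single i (d i) ≤ β := by simpa using hi
      have h1 : (β - Finsupp.single i (d i)).degree + d i = β.degree := by
        conv_rhs => rw [← tsub_add_cancel_of_le hle]
        simp
      have h2 := totalDegree_monomial_le (β - Finsupp.single i (d i)) (1 : K)
      have h3 := totalDegree_mul (monomial (β - Finsupp.single i (d i)) (1 : K)) (Q i)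
      have h4 := hQ i
      change _ ≤ (β - Finsupp.single i (d i)).degree at h2
      omega
    · rw [h]; exact V.zero_mem
  set T : Module.End K V := M.restrict hMV with hT
  refine ((T.finite_hasEigenvalue).preimage (neg_injective.injOn)).subset fun ε hε => ?_
  by_contra hne
  apply hε
  set I := (Ideal.span (Set.range fun i => Q i + C ε * X i ^ d i))
  set W := boxSpan K d ⊔ I.restrictScalars K
  let N : MvPolynomial σ K →ₗ[K] MvPolynomial σ K := ε • LinearMap.id + M
  have hN : ∀ p, N p = C ε * p + M p := fun p => by simp [N, smul_eq_C_mul]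
  have hred : V ≤ W.comap N := by
    refine restrictTotalDegree_le_of_monomial_mem fun β _ => ?_
    rw [Submodule.mem_comap]
    obtain ⟨i, hi, h⟩ | ⟨hlt, h⟩ := hM β
    · refine Submodule.mem_sup_right ?_
      have hle : Finsupp.single i (d i) ≤ β := by simpa using hi
      have : N (monomial β 1) =
          monomial (β - Finsupp.single i (d i)) 1 * (Q i + C ε * X i ^ d i) := by
        have hX : monomial β (1 : K) =
            monomial (β - Finsupp.single i (d i)) 1 * X i ^ d i := by
          rw [X_pow_eq_monomial, monomial_mul, tsub_add_cancel_of_le hle, one_mul]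
        rw [hN, h]
        conv_lhs => rw [hX]
        ring
      rw [this]
      exact I.mul_mem_left _ (Ideal.subset_span ⟨i, rfl⟩)
    · refine Submodule.mem_sup_left ?_
      simpa only [hN, h, add_zero, smul_eq_C_mul] using
        (boxSpan K d).smul_mem ε (monomial_mem_boxSpan hlt)
  have hsurj : ∀ p ∈ V, ∃ q ∈ V, N q = p := by
    have hunit : IsUnit (algebraMap K (Module.End K V) (-ε) - T) := by
      by_contra hn
      exact hne (Module.End.HasEigenvalue.of_mem_spectrum hn)
    have hr := (LinearMap.isUnit_iff_range_eq_top _).1 hunit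
    intro p hp
    obtain ⟨q, hq⟩ := LinearMap.range_eq_top.1 hr ⟨p, hp⟩
    refine ⟨-q, V.neg_mem q.2, ?_⟩
    have hval : (-ε) • (q : MvPolynomial σ K) - M q = p := congrArg Subtype.val hq
    rw [hN, ← hval, map_neg, smul_eq_C_mul, C_neg]
    ring
  have hVW : V ≤ W := by
    intro p hp
    obtain ⟨q, hq, rfl⟩ := hsurj p hp
    exact hred hq
  have hX : ∀ j, ∀ p ∈ W, p * X j ∈ W := by
    intro j
    suffices W ≤ W.comap (LinearMap.mulRight K (X j)) from this
    refine sup_le ?_ ?_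
    · rw [boxSpan, Submodule.span_le]
      rintro _ ⟨f, rfl⟩
      refine hVW ?_
      rw [hV, mem_restrictTotalDegree]
      refine (totalDegree_mul _ _).trans (add_le_add ?_ (totalDegree_X j).le)
      refine (totalDegree_monomial_le _ _).trans ?_
      change Finsupp.degree _ ≤ _
      rw [Finsupp.degree_eq_sum]
      exact Finset.sum_le_sum fun i _ => (f i).2.le
    · intro p hp
      exact Submodule.mem_sup_right (I.mul_mem_right _ hp)
  refine Submodule.eq_top_iff'.2 fun p => ?_
  induction p using MvPolynomial.induction_on with
  | C a => exact hVW (by simp [hV, mem_restrictTotalDegree])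
  | add p q hp hq => exact W.add_mem hp hq
  | mul_X p j hp => exact hX j p hp

omit [Fintype σ] in
theorem exists_eval_ne_zero_forall_eval_eq_zero (S : Finset (σ → K)) (x : σ → K) :
    ∃ p : MvPolynomial σ K, eval x p ≠ 0 ∧ ∀ y ∈ S, y ≠ x → eval y p = 0 := by
  classical
  have : ∀ y : σ → K, ∃ q : MvPolynomial σ K, y ≠ x → eval x q ≠ 0 ∧ eval y q = 0 := by
    intro y
    by_cases h : y = x
    · exact ⟨0, fun h' => absurd h h'⟩
    · obtain ⟨i, hi⟩ := Function.ne_iff.1 h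
      exact ⟨X i - C (y i), fun _ => ⟨by simpa [sub_eq_zero] using Ne.symm hi, by simp⟩⟩
  choose q hq using this
  refine ⟨∏ y ∈ S.erase x, q y, ?_, fun y hy hyx => ?_⟩
  · rw [map_prod, Finset.prod_ne_zero_iff]
    exact fun y hy => (hq y (Finset.ne_of_mem_erase hy)).1
  · rw [map_prod]
    exact Finset.prod_eq_zero (Finset.mem_erase.2 ⟨hyx, hy⟩) (hq y hyx).2

/-- If the monomials with exponents below `d` span modulo `I`, then `I` has at most `∏ i, d i`
zeros. -/
theorem card_le_of_boxSpan_sup_eq_top {d : σ → ℕ} {I : Ideal (MvPolynomial σ K)}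
    (h : boxSpan K d ⊔ I.restrictScalars K = ⊤) (S : Finset (σ → K))
    (hS : ∀ x ∈ S, ∀ p ∈ I, eval x p = 0) : S.card ≤ ∏ i, d i := by
  classical
  let E : MvPolynomial σ K →ₗ[K] (S → K) := LinearMap.pi fun x => (aeval (x : σ → K)).toLinearMap
  have hE : ∀ p x, E p x = eval (x : σ → K) p := fun p x => by simp [E, aeval_eq_eval]
  have htop : (boxSpan K d).map E = ⊤ := by
    have hI : (I.restrictScalars K).map E = ⊥ := by
      rw [eq_bot_iff]
      rintro _ ⟨p, hp, rfl⟩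
      ext x
      rw [hE]
      exact hS x x.2 p hp
    have : (boxSpan K d).map E = LinearMap.range E := by
      rw [LinearMap.range_eq_map, ← h, Submodule.map_sup, hI, sup_bot_eq]
    rw [this, eq_top_iff, ← (Pi.basisFun K S).span_eq, Submodule.span_le]
    rintro _ ⟨x, rfl⟩
    obtain ⟨p, hp, hp'⟩ := exists_eval_ne_zero_forall_eval_eq_zero S (x : σ → K)
    refine ⟨(eval (x : σ → K) p)⁻¹ • p, ?_⟩
    ext y
    rw [map_smul, Pi.smul_apply, hE, Pi.basisFun_apply]
    by_cases hxy : y = x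
    · subst hxy; simp [hp]
    · rw [hp' y y.2 (fun h => hxy (Subtype.ext h)), smul_zero, Pi.single_eq_of_ne hxy]
  calc S.card = Module.finrank K ((boxSpan K d).map E) := by rw [htop, finrank_top]; simp
    _ ≤ Module.finrank K (boxSpan K d) := Submodule.finrank_map_le _ _
    _ ≤ _ := finrank_boxSpan_le d

end Field

theorem hasStrictFDerivAt_eval {σ : Type*} [Fintype σ] (p : MvPolynomial σ ℝ) (x : σ → ℝ) :
    HasStrictFDerivAt (fun y => eval y p)
      (∑ j, eval x (pderiv j p) • ContinuousLinearMap.proj (R := ℝ) (φ := fun _ : σ => ℝ) j) x := by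
  classical
  induction p using MvPolynomial.induction_on with
  | C a => simpa using hasStrictFDerivAt_const (𝕜 := ℝ) a x
  | add p q hp hq =>
    simpa [add_smul, Finset.sum_add_distrib] using hp.fun_add hq
  | mul_X p i hp =>
    have hi : HasStrictFDerivAt (fun y : σ → ℝ => y i)
        (ContinuousLinearMap.proj (R := ℝ) (φ := fun _ : σ => ℝ) i) x :=
      (ContinuousLinearMap.proj (R := ℝ) (φ := fun _ : σ => ℝ) i).hasStrictFDerivAt
    have h := hp.fun_mul hi
    simp only [map_mul, eval_X]
    refine h.congr_fderiv ?_
    ext v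
    simp [pderiv_X, Pi.single_apply, add_mul, Finset.sum_add_distrib, Finset.mul_sum, apply_ite,
      mul_assoc]

/-- A nondegenerate zero of a polynomial system persists under small perturbations. -/
theorem eventually_exists_zero_add {σ : Type*} [Fintype σ] [DecidableEq σ]
    (Q R : σ → MvPolynomial σ ℝ) {x : σ → ℝ} (hx : ∀ i, eval x (Q i) = 0)
    (hJ : Matrix.det (Matrix.of fun i j => eval x (pderiv j (Q i))) ≠ 0) {U : Set (σ → ℝ)}
    (hU : U ∈ nhds x) :
    ∀ᶠ ε in nhds (0 : ℝ), ∃ y ∈ U, ∀ i, eval y (Q i + C ε * R i) = 0 := by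
  set A := Matrix.of fun i j => eval x (pderiv j (Q i)) with hA
  have hfst := hasStrictFDerivAt_fst (𝕜 := ℝ) (p := ((0 : ℝ), x))
  have hsnd := hasStrictFDerivAt_snd (𝕜 := ℝ) (p := ((0 : ℝ), x))
  have hG := hfst.prodMk <| hasStrictFDerivAt_pi.2 fun i =>
    ((hasStrictFDerivAt_eval (Q i) x).comp (0, x) hsnd).add
      (hfst.mul ((hasStrictFDerivAt_eval (R i) x).comp (0, x) hsnd))
  have hmap := hG.map_nhds_eq_of_surj ?_
  · have hmem : Set.univ ×ˢ U ∈ nhds ((0 : ℝ), x) := prod_mem_nhds Filter.univ_mem hU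
    have himg := Filter.image_mem_map (m := fun z : ℝ × (σ → ℝ) => (z.1, fun i =>
      eval z.2 (Q i) + z.1 * eval z.2 (R i))) hmem
    have hmap' : Filter.map (fun z : ℝ × (σ → ℝ) => (z.1, fun i =>
      eval z.2 (Q i) + z.1 * eval z.2 (R i))) (nhds ((0 : ℝ), x)) = nhds ((0 : ℝ), 0) := by
      refine hmap.trans (congrArg nhds ?_)
      ext i <;> simp [hx]
    rw [hmap'] at himg
    have hcont : Filter.Tendsto (fun ε : ℝ => (ε, (0 : σ → ℝ))) (nhds 0) (nhds (0, 0)) :=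
      (Continuous.prodMk_left (0 : σ → ℝ)).tendsto 0
    filter_upwards [hcont himg] with ε hε
    obtain ⟨⟨δ, y⟩, ⟨-, hy⟩, heq⟩ := hε
    obtain ⟨rfl, h2⟩ := Prod.mk.inj heq
    exact ⟨y, hy, fun i => by simpa using congrFun h2 i⟩
  · rw [LinearMap.range_eq_top]
    rintro ⟨h, w⟩
    obtain ⟨v, hv⟩ : ∃ v, A.mulVec v = fun i => w i - h * eval x (R i) :=
      ⟨A⁻¹.mulVec _, by rw [Matrix.mulVec_mulVec,
        Matrix.mul_nonsing_inv _ (isUnit_iff_ne_zero.2 hJ), Matrix.one_mulVec]⟩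
    refine ⟨(h, v), ?_⟩
    ext i
    · simp
    · have := congrFun hv i
      simp only [Matrix.mulVec, dotProduct, hA, Matrix.of_apply] at this
      simp [this, mul_comm h]

/-- **Bézout's inequality** for nondegenerate real zeros. -/
theorem card_le_prod_totalDegree_of_nondegenerate {σ : Type*} [Fintype σ] [DecidableEq σ]
    (Q : σ → MvPolynomial σ ℝ) (S : Finset (σ → ℝ)) (hS : ∀ x ∈ S, ∀ i, eval x (Q i) = 0)
    (hJ : ∀ x ∈ S, Matrix.det (Matrix.of fun i j => eval x (pderiv j (Q i))) ≠ 0)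
    {d : σ → ℕ} (hQ : ∀ i, (Q i).totalDegree ≤ d i) : S.card ≤ ∏ i, d i := by
  classical
  obtain ⟨U, hU, hdisj⟩ := S.finite_toSet.t2_separation
  have hpert : ∀ᶠ ε in nhds (0 : ℝ), ∀ x ∈ S, ∃ y ∈ U x, ∀ i,
      eval y (Q i + C ε * X i ^ d i) = 0 :=
    (Filter.eventually_all_finset S).2 fun x hx =>
      eventually_exists_zero_add Q _ (hS x hx) (hJ x hx) ((hU x).2.mem_nhds (hU x).1)
  have hgen := nhdsNE_le_cofinite (0 : ℝ)
    (finite_setOf_boxSpan_sup_ne_top d Q hQ).compl_mem_cofinite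
  obtain ⟨ε, hε, hspan⟩ := ((hpert.filter_mono nhdsWithin_le_nhds).and hgen).exists
  choose! y hyU hy using hε
  have hinj : Set.InjOn y S := by
    intro x hx x' hx' hxx'
    by_contra hne
    exact Set.disjoint_left.1 (hdisj hx hx' hne) (hyU x hx) (hxx' ▸ hyU x' hx')
  rw [← Finset.card_image_of_injOn hinj]
  refine card_le_of_boxSpan_sup_eq_top (not_not.1 hspan) _ fun z hz p hp => ?_
  obtain ⟨x, hx, rfl⟩ := Finset.mem_image.1 hz
  suffices Ideal.span _ ≤ RingHom.ker (eval (y x)) from this hp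
  rw [Ideal.span_le]
  rintro _ ⟨i, rfl⟩
  exact hy x hx i

end MvPolynomial

/-- If F : ℝⁿ → ℝⁿ is a polynomial mapping with everywhere nonzero Jacobian
determinant, then for every a ∈ ℝⁿ every solution of F(x) = a is an isolated point of the
fiber F⁻¹(a), the fiber is finite, and its cardinality is at most the product of the
total degrees of the components. -/
theorem stmt_9 (n : ℕ) (P : Fin n → MvPolynomial (Fin n) ℝ)
    (hJ : ∀ x : Fin n → ℝ,
      Matrix.det (Matrix.of fun i j => eval x (pderiv j (P i))) ≠ 0)
    (a : Fin n → ℝ) :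
    (∀ x ∈ (fun x : Fin n → ℝ => fun i => eval x (P i)) ⁻¹' {a},
      ∃ U ∈ nhds x, U ∩ ((fun x : Fin n → ℝ => fun i => eval x (P i)) ⁻¹' {a}) = {x}) ∧
    ((fun x : Fin n → ℝ => fun i => eval x (P i)) ⁻¹' {a}).Finite ∧
    ((fun x : Fin n → ℝ => fun i => eval x (P i)) ⁻¹' {a}).ncard ≤
      ∏ i, (P i).totalDegree := by
  set F := (fun x : Fin n → ℝ => fun i => eval x (P i)) ⁻¹' {a}
  have hcard : ∀ S : Finset (Fin n → ℝ), ↑S ⊆ F → S.card ≤ ∏ i, (P i).totalDegree := fun S hS =>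
    card_le_prod_totalDegree_of_nondegenerate (fun i => P i - C (a i)) S
      (fun x hx i => by simpa [sub_eq_zero] using congrFun (hS hx) i)
      (fun x _ => by simpa using hJ x) (fun i => totalDegree_sub_C_le _ _)
  have hfin : F.Finite := by
    by_contra hinf
    obtain ⟨S, hSF, hS⟩ := Set.Infinite.exists_subset_card_eq hinf (∏ i, (P i).totalDegree + 1)
    have := hcard S hSF
    omega
  refine ⟨fun x hx => ⟨(F \ {x})ᶜ, (hfin.sdiff.isClosed.isOpen_compl).mem_nhds (by simp), ?_⟩,
    hfin, ?_⟩
  · ext z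
    by_cases hz : z = x
    · simp [hz, hx]
    · simp [hz]
  · rw [Set.ncard_eq_toFinset_card F hfin]
    exact hcard _ (by simp)
end
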